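/- arXiv:math/0505138 — 2 statements merged into one kernel-verified Lean document; each statement's English description precedes it below -/
import Mathlib

section
/- For every α ∈ k with α ∉ {0, 1, ω, ω̄}, the stabilizer subgroup {g ∈ PGL(3,k) : g(Z_C(α)) = Z_C(α)} of the 21-point set Z_C(α) under the natural action of PGL(3,k) on P²(k) is equal to the image in PGL(3,k) of the set of matrices with rows (a, b, 0), (c, d, 0), (a²c²α + e, b²d²α + f, 1), where a, b, c, d, e, f ∈ F₄ and ad + bc = 1; in particular this stabilizer has order 960. -/
/-- The natural action of an invertible matrix `g ∈ GL(3,k)` on the projective plane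
`P²(k)`. -/
noncomputable def actGL (k : Type*) [Field k] (g : Matrix.GeneralLinearGroup (Fin 3) k) :
    Projectivization k (Fin 3 → k) → Projectivization k (Fin 3 → k) := fun P =>
  Projectivization.mk k ((g : Matrix (Fin 3) (Fin 3) k).mulVec P.rep) (by
    intro h
    apply P.rep_nonzero
    have h2 : ((g⁻¹ : Matrix.GeneralLinearGroup (Fin 3) k) : Matrix (Fin 3) (Fin 3) k).mulVec
        (((g : Matrix (Fin 3) (Fin 3) k)).mulVec P.rep) = P.rep := by
      rw [Matrix.mulVec_mulVec, g.inv_mul, Matrix.one_mulVec]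
    rw [h, Matrix.mulVec_zero] at h2
    exact h2.symm)

/-- `PGL(3,k)`: the quotient of `GL(3,k)` by its center (the nonzero scalar matrices). -/
abbrev PGL3 (k : Type*) [Field k] : Type _ :=
  Matrix.GeneralLinearGroup (Fin 3) k ⧸ Subgroup.center (Matrix.GeneralLinearGroup (Fin 3) k)

/-- The 21 coordinate vectors of the points of `Z_C(λ)` (ω̄ = ω + 1). -/
def ZCvec (k : Type*) [CommRing k] (ω l : k) : Set (Fin 3 → k) :=
  {![1, 1, l], ![1, 1, l + 1], ![1, 1, l + ω], ![1, 1, l + ω + 1],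
   ![1, ω + 1, ω * l + ω], ![1, ω + 1, ω * l], ![1, ω + 1, ω * l + 1],
   ![1, ω + 1, ω * l + ω + 1],
   ![1, ω, (ω + 1) * l + ω + 1], ![1, ω, (ω + 1) * l], ![1, ω, (ω + 1) * l + ω],
   ![1, ω, (ω + 1) * l + 1],
   ![1, 0, 1], ![1, 0, 0], ![1, 0, ω + 1], ![1, 0, ω],
   ![0, 1, 1], ![0, 1, 0], ![0, 1, ω + 1], ![0, 1, ω], ![0, 0, 1]}

/-- The 21-point set `Z_C(λ)` in the projective plane `P²(k)`. -/
def ZCpts (k : Type*) [Field k] (ω l : k) : Set (Projectivization k (Fin 3 → k)) :=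
  {P | ∃ v ∈ ZCvec k ω l, ∃ hv : v ≠ 0, P = Projectivization.mk k v hv}

/-- The stabilizer of a subset `Z ⊆ P²(k)` in `PGL(3,k)`: the elements of `PGL(3,k)` all of
whose lifts to `GL(3,k)` map `Z` onto itself. -/
def PGLstab (k : Type*) [Field k] (Z : Set (Projectivization k (Fin 3 → k))) : Set (PGL3 k) :=
  {x | ∀ g : Matrix.GeneralLinearGroup (Fin 3) k, QuotientGroup.mk g = x → actGL k g '' Z = Z}

section FourElementField

variable {k : Type*} [Field k] [CharP k 2]

/-- The solutions of `x ^ 4 = x` in a field of characteristic two. -/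
def fourSubfield (k : Type*) [Field k] [CharP k 2] : Subfield k :=
  (iterateFrobenius k 2 2).eqLocusField (RingHom.id k)

theorem mem_fourSubfield {x : k} : x ∈ fourSubfield k ↔ x ^ 4 = x := by
  simp [fourSubfield, RingHom.mem_eqLocusField, iterateFrobenius_def]

theorem mem_fourSubfield_iff {ω : k} (hω : ω ^ 2 + ω + 1 = 0) {x : k} :
    x ∈ fourSubfield k ↔ x ∈ ({0, 1, ω, ω + 1} : Set k) := by
  have two : (2 : k) = 0 := CharTwo.two_eq_zero
  have factor : x ^ 4 - x = x * (x - 1) * (x - ω) * (x - (ω + 1)) := by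
    linear_combination (x ^ 3 - x ^ 2) * (two * ω) + (x - x ^ 2) * hω + (x ^ 3 - x) * two
  rw [mem_fourSubfield, ← sub_eq_zero, factor]
  simp only [mul_eq_zero, sub_eq_zero, Set.mem_insert_iff, Set.mem_singleton_iff, or_assoc]

end FourElementField

section Cone

variable {k : Type*} [Field k] [CharP k 2]

/-- The affine vectors `(x, y, x²y²α + t)` with `x, y, t ∈ F₄`, whose projectivization
is `Z_C(α)`. -/
def IsConeVec (α : k) (v : Fin 3 → k) : Prop :=
  v 0 ∈ fourSubfield k ∧ v 1 ∈ fourSubfield k ∧ v 2 + v 0 ^ 2 * v 1 ^ 2 * α ∈ fourSubfield k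

theorem IsConeVec.smul {α : k} {v : Fin 3 → k} (hv : IsConeVec α v) {c : k}
    (hc : c ∈ fourSubfield k) : IsConeVec α (c • v) := by
  refine ⟨mul_mem hc hv.1, mul_mem hc hv.2.1, ?_⟩
  have h : c * v 2 + (c * v 0) ^ 2 * (c * v 1) ^ 2 * α = c * (v 2 + v 0 ^ 2 * v 1 ^ 2 * α) := by
    linear_combination v 0 ^ 2 * v 1 ^ 2 * α * mem_fourSubfield.1 hc
  simpa [h] using mul_mem hc hv.2.2

theorem isConeVec_of_mem_ZCvec {ω α : k} (hω : ω ^ 2 + ω + 1 = 0) {v : Fin 3 → k}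
    (hv : v ∈ ZCvec k ω α) : IsConeVec α v := by
  have two : (2 : k) = 0 := CharTwo.two_eq_zero
  simp only [ZCvec, Set.mem_insert_iff, Set.mem_singleton_iff] at hv
  simp only [IsConeVec, mem_fourSubfield_iff hω, Set.mem_insert_iff, Set.mem_singleton_iff]
  rcases hv with rfl | rfl | rfl | rfl | rfl | rfl | rfl | rfl | rfl | rfl | rfl | rfl | rfl |
    rfl | rfl | rfl | rfl | rfl | rfl | rfl | rfl <;>
  simp <;> grind

theorem IsConeVec.exists_smul_mem_ZCvec {ω α : k} (hω : ω ^ 2 + ω + 1 = 0) {v : Fin 3 → k}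
    (hv : IsConeVec α v) (h0 : v ≠ 0) : ∃ c : k, c ≠ 0 ∧ c • v ∈ ZCvec k ω α := by
  have two : (2 : k) = 0 := CharTwo.two_eq_zero
  have expand : ∀ w : Fin 3 → k, w = ![w 0, w 1, w 2] := fun w => by
    ext i; fin_cases i <;> rfl
  by_cases hx : v 0 = 0
  · by_cases hy : v 1 = 0
    · have hz : v 2 ≠ 0 := fun hz => h0 (by rw [expand v, hx, hy, hz]; simp)
      refine ⟨(v 2)⁻¹, inv_ne_zero hz, ?_⟩
      rw [expand (_ • v)]
      simp [hx, hy, hz, ZCvec]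
    · refine ⟨(v 1)⁻¹, inv_ne_zero hy, ?_⟩
      obtain ⟨-, -, ht⟩ := hv.smul (inv_mem hv.2.1)
      rw [expand (_ • v)]
      simp only [Pi.smul_apply, smul_eq_mul, hx, inv_mul_cancel₀ hy, mul_zero] at ht ⊢
      rw [mem_fourSubfield_iff hω] at ht
      generalize (v 1)⁻¹ * v 2 = z at ht ⊢
      simp only [Set.mem_insert_iff, Set.mem_singleton_iff] at ht
      simp [ZCvec]
      grind
  · refine ⟨(v 0)⁻¹, inv_ne_zero hx, ?_⟩
    obtain ⟨-, hy, ht⟩ := hv.smul (inv_mem hv.1)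
    rw [expand (_ • v)]
    simp only [Pi.smul_apply, smul_eq_mul, inv_mul_cancel₀ hx] at hy ht ⊢
    rw [mem_fourSubfield_iff hω] at hy ht
    generalize (v 0)⁻¹ * v 1 = y at hy ht ⊢
    generalize (v 0)⁻¹ * v 2 = z at ht ⊢
    have shift : ∀ s t : k, z + s = t ↔ z = s + t := fun s t => by
      rw [← CharTwo.sub_eq_add z, sub_eq_iff_eq_add']
    have hω_sq : ω ^ 2 = ω + 1 := by linear_combination hω - (ω + 1) * two
    have hω_add_sq : (ω + 1) ^ 2 = ω := by linear_combination hω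
    simp only [Set.mem_insert_iff, Set.mem_singleton_iff, shift, one_pow, one_mul] at hy ht
    rcases hy with rfl | rfl | rfl | rfl <;>
    simp only [hω_sq, hω_add_sq, one_pow, zero_pow two_ne_zero, zero_mul, one_mul, zero_add,
      add_zero, ← add_assoc] at ht <;>
    rcases ht with rfl | rfl | rfl | rfl <;>
    simp only [ZCvec, Set.mem_insert_iff, Set.mem_singleton_iff, true_or, or_true]

/-- A vector some nonzero multiple of which is an `IsConeVec`. -/
def InCone (α : k) (v : Fin 3 → k) : Prop :=
  ∃ c : k, c ≠ 0 ∧ IsConeVec α (c • v)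

theorem IsConeVec.inCone {α : k} {v : Fin 3 → k} (hv : IsConeVec α v) : InCone α v :=
  ⟨1, one_ne_zero, by simpa using hv⟩

theorem InCone.smul {α : k} {v : Fin 3 → k} (hv : InCone α v) {r : k} (hr : r ≠ 0) :
    InCone α (r • v) := by
  obtain ⟨c, hc, h⟩ := hv
  exact ⟨c * r⁻¹, by positivity, by rwa [smul_smul, inv_mul_cancel_right₀ hr]⟩

theorem mk_mem_ZCpts_iff {ω α : k} (hω : ω ^ 2 + ω + 1 = 0) {v : Fin 3 → k} (hv : v ≠ 0) :
    Projectivization.mk k v hv ∈ ZCpts k ω α ↔ InCone α v := by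
  constructor
  · rintro ⟨w, hw, hw0, h⟩
    obtain ⟨a, ha⟩ := (Projectivization.mk_eq_mk_iff k _ _ _ _).1 h
    rw [← ha]
    exact (isConeVec_of_mem_ZCvec hω hw).inCone.smul a.ne_zero
  · rintro ⟨c, hc, h⟩
    obtain ⟨d, hd, hmem⟩ := h.exists_smul_mem_ZCvec hω (smul_ne_zero hc hv)
    refine ⟨_, hmem, smul_ne_zero hd (smul_ne_zero hc hv), ?_⟩
    refine ((Projectivization.mk_eq_mk_iff' k _ _ _ _).2 ⟨d * c, ?_⟩).symm
    rw [smul_smul]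

end Cone

section Action

variable {k : Type*} [Field k]

open Matrix

theorem mulVec_ne_zero_of_GL (g : GL (Fin 3) k) {v : Fin 3 → k} (hv : v ≠ 0) :
    (g : Matrix (Fin 3) (Fin 3) k) *ᵥ v ≠ 0 := fun h =>
  hv (Matrix.mulVec_injective_of_isUnit g.isUnit (by rw [h, Matrix.mulVec_zero]))

theorem actGL_mk (g : GL (Fin 3) k) {v : Fin 3 → k} (hv : v ≠ 0) :
    actGL k g (Projectivization.mk k v hv) =
      Projectivization.mk k ((g : Matrix (Fin 3) (Fin 3) k) *ᵥ v) (mulVec_ne_zero_of_GL g hv) := by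
  obtain ⟨a, ha⟩ := Projectivization.exists_smul_eq_mk_rep k v hv
  refine (Projectivization.mk_eq_mk_iff k _ _ _ _).2 ⟨a, ?_⟩
  rw [← ha, Units.smul_def, Units.smul_def, Matrix.mulVec_smul]

theorem actGL_injective (g : GL (Fin 3) k) : Function.Injective (actGL k g) := by
  intro P Q h
  induction P using Projectivization.ind with | _ v hv
  induction Q using Projectivization.ind with | _ w hw
  rw [actGL_mk, actGL_mk, Projectivization.mk_eq_mk_iff'] at h
  obtain ⟨a, ha⟩ := h
  rw [← Matrix.mulVec_smul] at ha
  exact (Projectivization.mk_eq_mk_iff' k _ _ _ _).2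
    ⟨a, Matrix.mulVec_injective_of_isUnit g.isUnit ha⟩

theorem finite_ZCpts (ω α : k) : (ZCpts k ω α).Finite := by
  have hfin : (ZCvec k ω α).Finite := by
    unfold ZCvec
    exact Set.toFinite _
  have : Finite {v : Fin 3 → k // v ∈ ZCvec k ω α ∧ v ≠ 0} :=
    (hfin.subset (Set.sep_subset _ fun v => v ≠ 0)).to_subtype
  refine (Set.finite_range fun v : {v : Fin 3 → k // v ∈ ZCvec k ω α ∧ v ≠ 0} =>
    Projectivization.mk k v.1 v.2.2).subset ?_
  rintro P ⟨v, hv, hv0, rfl⟩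
  exact ⟨⟨v, hv, hv0⟩, rfl⟩

theorem actGL_image_ZCpts_eq_iff [CharP k 2] {ω α : k} (hω : ω ^ 2 + ω + 1 = 0)
    (g : GL (Fin 3) k) :
    actGL k g '' ZCpts k ω α = ZCpts k ω α ↔
      ∀ v, InCone α v → InCone α ((g : Matrix (Fin 3) (Fin 3) k) *ᵥ v) := by
  constructor
  · intro h v hv
    by_cases hv0 : v = 0
    · rwa [hv0, Matrix.mulVec_zero, ← hv0]
    · have hmem := Set.mem_image_of_mem (actGL k g) ((mk_mem_ZCpts_iff hω hv0).2 hv)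
      rwa [h, actGL_mk, mk_mem_ZCpts_iff hω] at hmem
  · intro h
    have hmaps : Set.MapsTo (actGL k g) (ZCpts k ω α) (ZCpts k ω α) := by
      intro P hP
      induction P using Projectivization.ind with | _ v hv
      rw [actGL_mk, mk_mem_ZCpts_iff hω]
      exact h v ((mk_mem_ZCpts_iff hω hv).1 hP)
    exact (((finite_ZCpts ω α).injOn_iff_bijOn_of_mapsTo hmaps).1
      (actGL_injective g).injOn).image_eq

theorem mk_eq_mk_iff_exists_smul {g h : GL (Fin 3) k} :
    (QuotientGroup.mk g : PGL3 k) = QuotientGroup.mk h ↔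
      ∃ r : k, r ≠ 0 ∧ (h : Matrix (Fin 3) (Fin 3) k) = r • (g : Matrix (Fin 3) (Fin 3) k) := by
  rw [QuotientGroup.eq, Matrix.GeneralLinearGroup.mem_center_iff_val_mem_range_scalar]
  constructor
  · rintro ⟨r, hr⟩
    have hgh : (h : Matrix (Fin 3) (Fin 3) k) = r • (g : Matrix (Fin 3) (Fin 3) k) := by
      rw [← mul_inv_cancel_left g h, Units.val_mul, ← hr, Matrix.scalar_apply,
        ← Matrix.smul_one_eq_diagonal, Matrix.mul_smul, mul_one]
    refine ⟨r, fun h0 => ?_, hgh⟩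
    rw [h0, zero_smul] at hgh
    exact h.ne_zero hgh
  · rintro ⟨r, -, hr⟩
    refine ⟨r, ?_⟩
    rw [Units.val_mul, hr, Matrix.mul_smul, ← Units.val_mul, inv_mul_cancel, Matrix.scalar_apply,
      ← Matrix.smul_one_eq_diagonal, Units.val_one]

end Action

section Lines

variable {k : Type*} [Field k] [CharP k 2] {α : k}

open Matrix

/-- On the chart `v 0 ≠ 0`, the points of `Z_C(α)` are `[1 : y : y²α + t]` with `y, t ∈ F₄`. -/
theorem InCone.exists_coords {v : Fin 3 → k} (hv : InCone α v) (h0 : v 0 ≠ 0) :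
    ∃ y ∈ fourSubfield k, ∃ t ∈ fourSubfield k, v = v 0 • ![1, y, y ^ 2 * α + t] := by
  obtain ⟨c, hc, h⟩ := hv
  have hcv : c * v 0 ≠ 0 := mul_ne_zero hc h0
  obtain ⟨-, hy, ht⟩ := h.smul (inv_mem h.1)
  simp only [Pi.smul_apply, smul_eq_mul, inv_mul_cancel₀ hcv] at hy ht
  refine ⟨_, hy, _, ht, ?_⟩
  have two : (2 : k) = 0 := CharTwo.two_eq_zero
  ext i
  fin_cases i
  · simp
  · simp; field_simp
  · simp; field_simp; linear_combination -(v 1 ^ 2 * α) * two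

/-- A line not through `[0 : 0 : 1]` contains at most two points of `Z_C(α)` off the line
`v 0 = 0`. -/
theorem eq_of_three_on_line (hα : α ∉ fourSubfield k) {u w : k} {x y z r s t : k}
    (hx : x ∈ fourSubfield k) (hy : y ∈ fourSubfield k) (hz : z ∈ fourSubfield k)
    (hr : r ∈ fourSubfield k) (hs : s ∈ fourSubfield k) (ht : t ∈ fourSubfield k)
    (hxr : x ^ 2 * α + r = u + w * x) (hys : y ^ 2 * α + s = u + w * y)
    (hzt : z ^ 2 * α + t = u + w * z) : x = y ∨ x = z ∨ y = z := by
  have two : (2 : k) = 0 := CharTwo.two_eq_zero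
  have hβ : α ^ 4 - α ≠ 0 := fun h => hα (mem_fourSubfield.2 (sub_eq_zero.1 h))
  have quadratic : ∀ {x r : k}, x ∈ fourSubfield k → r ∈ fourSubfield k →
      x ^ 2 * α + r = u + w * x → x ^ 2 * (α ^ 4 - α) = (u ^ 4 - u) + (w ^ 4 - w) * x := by
    intro x r hx hr h
    rw [mem_fourSubfield] at hx hr
    have h4 : x ^ 8 * α ^ 4 + r ^ 4 = u ^ 4 + w ^ 4 * x ^ 4 := by
      have := congrArg (iterateFrobenius k 2 2) h
      simp only [map_add, map_mul, iterateFrobenius_def] at this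
      linear_combination this
    have hx8 : x ^ 8 = x ^ 2 := by linear_combination (x ^ 4 + x) * hx
    rw [hx8, hr, hx] at h4
    linear_combination h4 - h
  have key : ∀ {a b : k}, a ^ 2 * (α ^ 4 - α) = (u ^ 4 - u) + (w ^ 4 - w) * a →
      b ^ 2 * (α ^ 4 - α) = (u ^ 4 - u) + (w ^ 4 - w) * b → a ≠ b →
      (a + b) * (α ^ 4 - α) = w ^ 4 - w := by
    intro a b ha hb hab
    refine mul_left_cancel₀ (sub_ne_zero.2 hab) ?_
    linear_combination ha - hb
  by_contra! hne
  obtain ⟨hxy, hxz, hyz⟩ := hne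
  have h1 := key (quadratic hx hr hxr) (quadratic hy hs hys) hxy
  have h2 := key (quadratic hx hr hxr) (quadratic hz ht hzt) hxz
  exact hyz (add_left_cancel (mul_right_cancel₀ hβ (h1.trans h2.symm)))

theorem false_of_three_on_line (hα : α ∉ fourSubfield k) {φ : Fin 3 → k} (hφ : φ 2 ≠ 0)
    {p q r : Fin 3 → k} (hp : InCone α p) (hq : InCone α q) (hr : InCone α r)
    (hp0 : p 0 ≠ 0) (hq0 : q 0 ≠ 0) (hr0 : r 0 ≠ 0)
    (hφp : φ ⬝ᵥ p = 0) (hφq : φ ⬝ᵥ q = 0) (hφr : φ ⬝ᵥ r = 0)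
    (hpq : q 0 • p ≠ p 0 • q) (hpr : r 0 • p ≠ p 0 • r) (hqr : r 0 • q ≠ q 0 • r) : False := by
  obtain ⟨x, hx, s, hs, hpe⟩ := hp.exists_coords hp0
  obtain ⟨y, hy, t, ht, hqe⟩ := hq.exists_coords hq0
  obtain ⟨z, hz, e, he, hre⟩ := hr.exists_coords hr0
  generalize p 0 = p₀, q 0 = q₀, r 0 = r₀ at *
  subst hpe hqe hre
  have line : ∀ {c x s : k}, c ≠ 0 → φ ⬝ᵥ (c • ![1, x, x ^ 2 * α + s]) = 0 →
      x ^ 2 * α + s = -(φ 0 / φ 2) + -(φ 1 / φ 2) * x := by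
    intro c x s hc h
    rw [dotProduct_smul, smul_eq_mul, mul_eq_zero, or_iff_right hc] at h
    simp [dotProduct, Fin.sum_univ_three] at h
    field_simp
    linear_combination h
  have hp1 := line hp0 hφp
  have hq1 := line hq0 hφq
  have hr1 := line hr0 hφr
  rcases eq_of_three_on_line hα hx hy hz hs ht he hp1 hq1 hr1 with rfl | rfl | rfl
  · exact hpq (by rw [hp1, hq1, smul_comm])
  · exact hpr (by rw [hp1, hr1, smul_comm])
  · exact hqr (by rw [hq1, hr1, smul_comm])

end Lines

section FixedPoint

variable {k : Type*} [Field k] [CharP k 2] {α : k}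

open Matrix

theorem false_of_four_on_line (hα : α ∉ fourSubfield k) {φ : Fin 3 → k} (hφ : φ 2 ≠ 0)
    {p : Fin 4 → Fin 3 → k} (hp : ∀ i, InCone α (p i)) (hφp : ∀ i, φ ⬝ᵥ p i = 0)
    (hind : ∀ i j, i ≠ j → ∀ s t : k, s • p i = t • p j → s = 0) : False := by
  have line : ∀ i, p i 0 = 0 → φ 1 * p i 1 + φ 2 * p i 2 = 0 := fun i hi => by
    have := hφp i
    simpa [dotProduct, Fin.sum_univ_three, hi] using this
  have unique : ∀ i j, i ≠ j → p i 0 = 0 → p j 0 ≠ 0 := by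
    intro i j hij hi hj
    have h1 : p j 1 • p i = p i 1 • p j := by
      ext n
      fin_cases n
      · simp [hi, hj]
      · exact mul_comm _ _
      · refine mul_left_cancel₀ hφ ?_
        simp only [Fin.reduceFinMk, Pi.smul_apply, smul_eq_mul]
        linear_combination p j 1 * line i hi - p i 1 * line j hj
    have h2 : p i 1 = 0 := hind j i hij.symm _ _ h1.symm
    have h3 : p i 2 = 0 := by
      have := line i hi
      rw [h2, mul_zero, zero_add] at this
      exact (mul_eq_zero.1 this).resolve_left hφ
    refine one_ne_zero (hind i j hij 1 0 ?_)
    ext n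
    fin_cases n <;> simp [hi, h2, h3]
  obtain ⟨i, hi⟩ : ∃ i, ∀ j, j ≠ i → p j 0 ≠ 0 := by
    by_cases h : ∃ i, p i 0 = 0
    · obtain ⟨i, hi⟩ := h
      exact ⟨i, fun j hj => unique i j hj.symm hi⟩
    · exact ⟨0, fun j _ hj => h ⟨j, hj⟩⟩
  have hne : ∀ i : Fin 4, i + 1 ≠ i ∧ i + 2 ≠ i ∧ i + 3 ≠ i ∧ i + 1 ≠ i + 2 ∧ i + 1 ≠ i + 3 ∧
      i + 2 ≠ i + 3 := by decide
  obtain ⟨h1, h2, h3, h12, h13, h23⟩ := hne i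
  exact false_of_three_on_line hα hφ (hp (i + 1)) (hp (i + 2)) (hp (i + 3)) (hi _ h1) (hi _ h2)
    (hi _ h3) (hφp _) (hφp _) (hφp _)
    (fun h => hi _ h2 (hind _ _ h12 _ _ h)) (fun h => hi _ h3 (hind _ _ h13 _ _ h))
    (fun h => hi _ h3 (hind _ _ h23 _ _ h))

/-- An enumeration of the four-element field. -/
def fourElt (ω : k) : Fin 4 → k := ![0, 1, ω, ω + 1]

omit [CharP k 2] in
theorem range_fourElt (ω : k) : Set.range (fourElt ω) = {0, 1, ω, ω + 1} := by
  simp only [fourElt, Matrix.range_cons, Matrix.range_empty, Set.union_empty, Set.singleton_union]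

theorem fourElt_mem {ω : k} (hω : ω ^ 2 + ω + 1 = 0) (i : Fin 4) :
    fourElt ω i ∈ fourSubfield k := by
  rw [mem_fourSubfield_iff hω, ← range_fourElt]
  exact Set.mem_range_self i

theorem fourElt_injective {ω : k} (hω : ω ^ 2 + ω + 1 = 0) : Function.Injective (fourElt ω) := by
  have two : (2 : k) = 0 := CharTwo.two_eq_zero
  intro i j h
  fin_cases i <;> fin_cases j <;> simp [fourElt] at h ⊢ <;> grind

theorem inv_apply_two_eq_zero {ω : k} (hω : ω ^ 2 + ω + 1 = 0) (hα : α ∉ fourSubfield k)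
    {g : GL (Fin 3) k} (hg : ∀ v, InCone α v → InCone α ((g : Matrix (Fin 3) (Fin 3) k) *ᵥ v))
    {a b : k} (ha : a ∈ fourSubfield k) (hb : b ∈ fourSubfield k) (hab : a * b = 0)
    (hne : a ≠ 0 ∨ b ≠ 0) {n : Fin 3} (hn : ∀ t : k, ![a, b, t] n = 0) :
    ((g⁻¹ : GL (Fin 3) k) : Matrix (Fin 3) (Fin 3) k) n 2 = 0 := by
  by_contra hφ
  refine false_of_four_on_line hα (φ := ((g⁻¹ : GL (Fin 3) k) : Matrix (Fin 3) (Fin 3) k) n) hφ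
    (p := fun i => (g : Matrix (Fin 3) (Fin 3) k) *ᵥ ![a, b, fourElt ω i])
    (fun i => hg _ (IsConeVec.inCone ⟨ha, hb, ?_⟩)) (fun i => ?_) fun i j hij s t hst => ?_
  · have hsq : a ^ 2 * b ^ 2 = 0 := by rw [← mul_pow, hab, zero_pow two_ne_zero]
    simpa [hsq] using fourElt_mem hω i
  · change (((g⁻¹ : GL (Fin 3) k) : Matrix (Fin 3) (Fin 3) k) *ᵥ _) n = 0
    rw [Matrix.mulVec_mulVec, ← Units.val_mul, inv_mul_cancel, Units.val_one, Matrix.one_mulVec, hn]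
  · rw [← Matrix.mulVec_smul, ← Matrix.mulVec_smul] at hst
    have hv := Matrix.mulVec_injective_of_isUnit g.isUnit hst
    have h0 := congrFun hv 0
    have h1 := congrFun hv 1
    have h2 := congrFun hv 2
    simp at h0 h1 h2
    have hst' : s = t := by
      rcases hne with h | h
      · exact h0.resolve_right h
      · exact h1.resolve_right h
    rw [← hst'] at h2
    by_contra hs
    exact hij (fourElt_injective hω (mul_left_cancel₀ hs h2))

/-- A matrix preserving `Z_C(α)` fixes the point `[0 : 0 : 1]`. -/
theorem exists_mulVec_single_two_eq_smul {ω : k} (hω : ω ^ 2 + ω + 1 = 0)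
    (hα : α ∉ fourSubfield k) {g : GL (Fin 3) k}
    (hg : ∀ v, InCone α v → InCone α ((g : Matrix (Fin 3) (Fin 3) k) *ᵥ v)) :
    ∃ r : k, r ≠ 0 ∧ (g : Matrix (Fin 3) (Fin 3) k) *ᵥ ![0, 0, 1] = r • ![0, 0, 1] := by
  have h0 := inv_apply_two_eq_zero hω hα hg (zero_mem _) (one_mem _) (zero_mul 1)
    (Or.inr one_ne_zero) (n := 0) (by simp)
  have h1 := inv_apply_two_eq_zero hω hα hg (one_mem _) (zero_mem _) (mul_zero 1)
    (Or.inl one_ne_zero) (n := 1) (by simp)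
  set c := ((g⁻¹ : GL (Fin 3) k) : Matrix (Fin 3) (Fin 3) k) 2 2 with hc
  have hinv : ((g⁻¹ : GL (Fin 3) k) : Matrix (Fin 3) (Fin 3) k) *ᵥ ![0, 0, 1] =
      c • ![0, 0, 1] := by
    ext i
    fin_cases i <;> simp [Matrix.mulVec, dotProduct, Fin.sum_univ_three, h0, h1, hc,
      -Matrix.coe_units_inv]
  have hgc : c • (g : Matrix (Fin 3) (Fin 3) k) *ᵥ ![0, 0, 1] = ![0, 0, 1] := by
    rw [← Matrix.mulVec_smul, ← hinv, Matrix.mulVec_mulVec, ← Units.val_mul, mul_inv_cancel,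
      Units.val_one, Matrix.one_mulVec]
  have hc0 : c ≠ 0 := fun h => by
    rw [h, zero_smul] at hgc
    simpa using congrFun hgc 2
  exact ⟨c⁻¹, inv_ne_zero hc0, by rw [eq_inv_smul_iff₀ hc0, hgc]⟩

end FixedPoint

section NormalForm

variable {k : Type*} [Field k] [CharP k 2] {α : k}

open Matrix

/-- If two points of `Z_C(α)` on a line through `[0 : 0 : 1]` have representatives differing by
`(0, 0, 1)`, those representatives are normalized. -/
theorem InCone.isConeVec_of_add {v : Fin 3 → k} (hv : InCone α v)
    (hv' : InCone α (v + ![0, 0, 1])) (h0 : v 0 ≠ 0 ∨ v 1 ≠ 0) : IsConeVec α v := by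
  obtain ⟨c, hc, h⟩ := hv
  obtain ⟨d, hd, h'⟩ := hv'
  have hv0 : (v + ![0, 0, 1] : Fin 3 → k) 0 = v 0 := add_zero _
  have hv1 : (v + ![0, 0, 1] : Fin 3 → k) 1 = v 1 := add_zero _
  have hv2 : (v + ![0, 0, 1] : Fin 3 → k) 2 = v 2 + 1 := rfl
  have hr : c * d⁻¹ ∈ fourSubfield k := by
    simp only [IsConeVec, Pi.smul_apply, hv0, hv1, smul_eq_mul] at h h'
    rw [← div_eq_mul_inv]
    rcases h0 with hi | hi
    · simpa only [mul_div_mul_right _ _ hi] using div_mem h.1 h'.1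
    · simpa only [mul_div_mul_right _ _ hi] using div_mem h.2.1 h'.2.1
  have hadd := (h'.smul hr).2.2
  rw [smul_smul, inv_mul_cancel_right₀ hd] at hadd
  have hcF : c ∈ fourSubfield k := by
    have := sub_mem hadd h.2.2
    simp only [Pi.smul_apply, hv0, hv1, hv2, smul_eq_mul] at this
    ring_nf at this
    exact this
  simpa only [inv_smul_smul₀ hc] using h.smul (inv_mem hcF)

/-- The matrices representing the stabilizer of `Z_C(α)`. -/
def stabMatrix (α a b c d e f : k) : Matrix (Fin 3) (Fin 3) k :=
  !![a, b, 0; c, d, 0; a ^ 2 * c ^ 2 * α + e, b ^ 2 * d ^ 2 * α + f, 1]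

theorem det_stabMatrix (α a b c d e f : k) : (stabMatrix α a b c d e f).det = a * d + b * c := by
  simp [stabMatrix, Matrix.det_fin_three, CharTwo.sub_eq_add]

omit [CharP k 2] in
theorem stabMatrix_mulVec (α a b c d e f : k) (v : Fin 3 → k) :
    stabMatrix α a b c d e f *ᵥ v =
      ![a * v 0 + b * v 1, c * v 0 + d * v 1,
        (a ^ 2 * c ^ 2 * α + e) * v 0 + (b ^ 2 * d ^ 2 * α + f) * v 1 + v 2] := by
  ext i
  fin_cases i <;> simp [stabMatrix, Matrix.mulVec, dotProduct, Fin.sum_univ_three]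

theorem IsConeVec.stabMatrix_mulVec {a b c d e f : k} (ha : a ∈ fourSubfield k)
    (hb : b ∈ fourSubfield k) (hc : c ∈ fourSubfield k) (hd : d ∈ fourSubfield k)
    (he : e ∈ fourSubfield k) (hf : f ∈ fourSubfield k) (hdet : a * d + b * c = 1)
    {v : Fin 3 → k} (hv : IsConeVec α v) : IsConeVec α (stabMatrix α a b c d e f *ᵥ v) := by
  obtain ⟨hx, hy, hz⟩ := hv
  rw [_root_.stabMatrix_mulVec]
  refine ⟨add_mem (mul_mem ha hx) (mul_mem hb hy), add_mem (mul_mem hc hx) (mul_mem hd hy), ?_⟩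
  have two : (2 : k) = 0 := CharTwo.two_eq_zero
  convert add_mem (add_mem (mul_mem he hx) (mul_mem hf hy)) hz using 1
  rw [mem_fourSubfield] at hx hy
  simp only [Matrix.cons_val, CharTwo.add_sq, mul_pow]
  linear_combination a ^ 2 * c ^ 2 * α * hx + b ^ 2 * d ^ 2 * α * hy +
    α * v 0 ^ 2 * v 1 ^ 2 * (a * d + b * c + 1) * hdet +
    (a ^ 2 * c ^ 2 * α * v 0 + b ^ 2 * d ^ 2 * α * v 1 -
      a * b * c * d * α * v 0 ^ 2 * v 1 ^ 2) * two

theorem exists_eq_stabMatrix (hα : α ∉ fourSubfield k) {M : Matrix (Fin 3) (Fin 3) k}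
    (hinj : Function.Injective M.mulVec) (hM : ∀ v, InCone α v → InCone α (M *ᵥ v))
    (hfix : M *ᵥ ![0, 0, 1] = ![0, 0, 1]) :
    ∃ a ∈ fourSubfield k, ∃ b ∈ fourSubfield k, ∃ c ∈ fourSubfield k, ∃ d ∈ fourSubfield k,
      ∃ e ∈ fourSubfield k, ∃ f ∈ fourSubfield k,
        a * d + b * c = 1 ∧ M = stabMatrix α a b c d e f := by
  have two : (2 : k) = 0 := CharTwo.two_eq_zero
  have map_cone : ∀ v : Fin 3 → k, IsConeVec α v → v 0 ≠ 0 ∨ v 1 ≠ 0 →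
      IsConeVec α (M *ᵥ v) := by
    intro v hv h0
    refine (hM v hv.inCone).isConeVec_of_add ?_ ?_
    · rw [← hfix, ← Matrix.mulVec_add]
      refine hM _ (IsConeVec.inCone ⟨?_, ?_, ?_⟩)
      · simpa using hv.1
      · simpa using hv.2.1
      · have := add_mem hv.2.2 (one_mem (fourSubfield k))
        rw [add_right_comm] at this
        simpa using this
    · by_contra! h
      have heq : M *ᵥ v = M *ᵥ ((M *ᵥ v) 2 • ![0, 0, 1]) := by
        rw [Matrix.mulVec_smul, hfix]
        ext i
        fin_cases i <;> simp [h.1, h.2]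
      have hv2 := hinj heq
      rcases h0 with h0 | h0
      · exact h0 (by simpa using congrFun hv2 0)
      · exact h0 (by simpa using congrFun hv2 1)
  have hfix0 := congrFun hfix 0
  have hfix1 := congrFun hfix 1
  have hfix2 := congrFun hfix 2
  obtain ⟨ha, hc, he⟩ := map_cone ![1, 0, 0] ⟨one_mem _, zero_mem _, by simp⟩ (by simp)
  obtain ⟨hb, hd, hf⟩ := map_cone ![0, 1, 0] ⟨zero_mem _, one_mem _, by simp⟩ (by simp)
  obtain ⟨-, -, h⟩ := map_cone ![1, 1, α]
    ⟨one_mem _, one_mem _, by simp [CharTwo.add_self_eq_zero]⟩ (by simp)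
  simp [Matrix.mulVec, dotProduct, Fin.sum_univ_three] at hfix0 hfix1 hfix2 ha hc he hb hd hf h
  refine ⟨_, ha, _, hb, _, hc, _, hd, _, he, _, hf, ?_, ?_⟩
  · have hmem := sub_mem (sub_mem h he) hf
    have hmul : ((M 0 0 * M 1 1 + M 0 1 * M 1 0) ^ 2 + 1) * α ∈ fourSubfield k := by
      convert hmem using 1
      rw [hfix0, hfix1, hfix2]
      simp only [CharTwo.add_sq, mul_pow]
      ring
    have hcoef : (M 0 0 * M 1 1 + M 0 1 * M 1 0) ^ 2 + 1 ∈ fourSubfield k :=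
      add_mem (pow_mem (add_mem (mul_mem ha hd) (mul_mem hb hc)) 2) (one_mem _)
    have hzero : (M 0 0 * M 1 1 + M 0 1 * M 1 0) ^ 2 + 1 = 0 := by
      by_contra hne
      refine hα ?_
      have := mul_mem (inv_mem hcoef) hmul
      rwa [inv_mul_cancel_left₀ hne] at this
    have hsq : (M 0 0 * M 1 1 + M 0 1 * M 1 0 + 1) ^ 2 = 0 := by
      rw [CharTwo.add_sq, one_pow, hzero]
    exact CharTwo.add_eq_zero.1 (pow_eq_zero_iff two_ne_zero |>.1 hsq)
  · ext i j
    fin_cases i <;> fin_cases j <;> simp [stabMatrix, hfix0, hfix1, hfix2]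
    · linear_combination -(M 0 0 ^ 2 * M 1 0 ^ 2 * α) * two
    · linear_combination -(M 0 1 ^ 2 * M 1 1 ^ 2 * α) * two

end NormalForm

section Counting

variable {k : Type*} [Field k] [CharP k 2]

/-- The addition table of the four-element field, in the enumeration `fourElt`. -/
def fourAdd (i j : Fin 4) : Fin 4 :=
  !![0, 1, 2, 3; 1, 0, 3, 2; 2, 3, 0, 1; 3, 2, 1, 0] i j

/-- The multiplication table of the four-element field, in the enumeration `fourElt`. -/
def fourMul (i j : Fin 4) : Fin 4 :=
  !![0, 0, 0, 0; 0, 1, 2, 3; 0, 2, 3, 1; 0, 3, 1, 2] i j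

theorem fourElt_add (ω : k) (i j : Fin 4) :
    fourElt ω (fourAdd i j) = fourElt ω i + fourElt ω j := by
  have two : (2 : k) = 0 := CharTwo.two_eq_zero
  fin_cases i <;> fin_cases j <;> simp [fourElt, fourAdd] <;> grind

theorem fourElt_mul {ω : k} (hω : ω ^ 2 + ω + 1 = 0) (i j : Fin 4) :
    fourElt ω (fourMul i j) = fourElt ω i * fourElt ω j := by
  have two : (2 : k) = 0 := CharTwo.two_eq_zero
  fin_cases i <;> fin_cases j <;> simp [fourElt, fourMul] <;> grind

/-- Index set for `SL(2, F₄) × F₄ × F₄`. -/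
abbrev StabIndex : Type :=
  {p : Fin 4 × Fin 4 × Fin 4 × Fin 4 //
    fourAdd (fourMul p.1 p.2.2.2) (fourMul p.2.1 p.2.2.1) = 1} × Fin 4 × Fin 4

theorem card_stabIndex : Nat.card StabIndex = 960 := by
  rw [Nat.card_prod, Nat.card_prod, Nat.card_eq_fintype_card (α := Fin 4), Fintype.card_fin,
    Nat.card_eq_fintype_card, Fintype.card_subtype]
  have : (Finset.univ.filter fun p : Fin 4 × Fin 4 × Fin 4 × Fin 4 =>
    fourAdd (fourMul p.1 p.2.2.2) (fourMul p.2.1 p.2.2.1) = 1).card = 60 := by decide +kernel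
  rw [this]

/-- The invertible matrix with underlying matrix `stabMatrix α a b c d e f`. -/
noncomputable def stabGL (α : k) {a b c d : k} (h : a * d + b * c = 1) (e f : k) :
    Matrix.GeneralLinearGroup (Fin 3) k :=
  Matrix.GeneralLinearGroup.mkOfDetNeZero (stabMatrix α a b c d e f)
    (by rw [det_stabMatrix, h]; exact one_ne_zero)

theorem coe_stabGL (α : k) {a b c d : k} (h : a * d + b * c = 1) (e f : k) :
    (stabGL α h e f : Matrix (Fin 3) (Fin 3) k) = stabMatrix α a b c d e f := rfl

theorem mk_stabGL_eq_iff {α a b c d e f a' b' c' d' e' f' : k} (h : a * d + b * c = 1)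
    (h' : a' * d' + b' * c' = 1) :
    (QuotientGroup.mk (stabGL α h e f) : PGL3 k) = QuotientGroup.mk (stabGL α h' e' f') ↔
      a = a' ∧ b = b' ∧ c = c' ∧ d = d' ∧ e = e' ∧ f = f' := by
  rw [mk_eq_mk_iff_exists_smul, coe_stabGL, coe_stabGL]
  constructor
  · rintro ⟨r, -, hr⟩
    have entry := fun i j => congrFun (congrFun hr i) j
    have h22 := entry 2 2
    simp [stabMatrix] at h22
    subst h22
    have h00 := entry 0 0
    have h01 := entry 0 1
    have h10 := entry 1 0
    have h11 := entry 1 1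
    have h20 := entry 2 0
    have h21 := entry 2 1
    simp [stabMatrix] at h00 h01 h10 h11 h20 h21
    subst h00 h01 h10 h11
    simp at h20 h21
    simp [h20, h21]
  · rintro ⟨rfl, rfl, rfl, rfl, rfl, rfl⟩
    exact ⟨1, one_ne_zero, (one_smul _ _).symm⟩

theorem fourElt_det {ω : k} (hω : ω ^ 2 + ω + 1 = 0) {a b c d : Fin 4} :
    fourElt ω a * fourElt ω d + fourElt ω b * fourElt ω c = 1 ↔
      fourAdd (fourMul a d) (fourMul b c) = 1 := by
  rw [← fourElt_mul hω, ← fourElt_mul hω, ← fourElt_add, ← (fourElt_injective hω).eq_iff]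
  rfl

/-- The classes in `PGL(3,k)` of the matrices `stabMatrix`, indexed by `StabIndex`. -/
noncomputable def stabPGL {ω : k} (hω : ω ^ 2 + ω + 1 = 0) (α : k) (p : StabIndex) : PGL3 k :=
  QuotientGroup.mk (stabGL α ((fourElt_det hω).2 p.1.2) (fourElt ω p.2.1) (fourElt ω p.2.2))

theorem stabPGL_injective {ω : k} (hω : ω ^ 2 + ω + 1 = 0) (α : k) :
    Function.Injective (stabPGL hω α) := by
  rintro ⟨⟨⟨a, b, c, d⟩, h⟩, e, f⟩ ⟨⟨⟨a', b', c', d'⟩, h'⟩, e', f'⟩ heq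
  obtain ⟨ha, hb, hc, hd, he, hf⟩ := (mk_stabGL_eq_iff _ _).1 heq
  have inj := fourElt_injective hω
  obtain rfl : a = a' := inj ha
  obtain rfl : b = b' := inj hb
  obtain rfl : c = c' := inj hc
  obtain rfl : d = d' := inj hd
  obtain rfl : e = e' := inj he
  obtain rfl : f = f' := inj hf
  rfl

theorem range_stabPGL {ω : k} (hω : ω ^ 2 + ω + 1 = 0) (α : k) :
    Set.range (stabPGL hω α) =
      {x : PGL3 k | ∃ g : Matrix.GeneralLinearGroup (Fin 3) k,
        (∃ a b c d e f : k,
          a ∈ ({0, 1, ω, ω + 1} : Set k) ∧ b ∈ ({0, 1, ω, ω + 1} : Set k) ∧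
          c ∈ ({0, 1, ω, ω + 1} : Set k) ∧ d ∈ ({0, 1, ω, ω + 1} : Set k) ∧
          e ∈ ({0, 1, ω, ω + 1} : Set k) ∧ f ∈ ({0, 1, ω, ω + 1} : Set k) ∧
          a * d + b * c = 1 ∧
          (g : Matrix (Fin 3) (Fin 3) k) = stabMatrix α a b c d e f) ∧
        QuotientGroup.mk g = x} := by
  rw [← range_fourElt]
  ext x
  constructor
  · rintro ⟨p, rfl⟩
    exact ⟨_, ⟨_, _, _, _, _, _, ⟨_, rfl⟩, ⟨_, rfl⟩, ⟨_, rfl⟩, ⟨_, rfl⟩, ⟨_, rfl⟩, ⟨_, rfl⟩,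
      (fourElt_det hω).2 p.1.2, coe_stabGL _ _ _ _⟩, rfl⟩
  · rintro ⟨g, ⟨_, _, _, _, _, _, ⟨a, rfl⟩, ⟨b, rfl⟩, ⟨c, rfl⟩, ⟨d, rfl⟩, ⟨e, rfl⟩, ⟨f, rfl⟩,
      hdet, hg⟩, rfl⟩
    refine ⟨⟨⟨⟨a, b, c, d⟩, (fourElt_det hω).1 hdet⟩, e, f⟩, ?_⟩
    exact congrArg QuotientGroup.mk (Units.ext hg.symm)

end Counting

theorem InCone.stabMatrix_mulVec {k : Type*} [Field k] [CharP k 2] {α a b c d e f : k}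
    (ha : a ∈ fourSubfield k) (hb : b ∈ fourSubfield k) (hc : c ∈ fourSubfield k)
    (hd : d ∈ fourSubfield k) (he : e ∈ fourSubfield k) (hf : f ∈ fourSubfield k)
    (hdet : a * d + b * c = 1) {v : Fin 3 → k} (hv : InCone α v) :
    InCone α ((stabMatrix α a b c d e f).mulVec v) := by
  obtain ⟨s, hs, h⟩ := hv
  refine ⟨s, hs, ?_⟩
  rw [← Matrix.mulVec_smul]
  exact h.stabMatrix_mulVec ha hb hc hd he hf hdet

/-- for `α ∉ {0,1,ω,ω̄}`, the stabilizer in `PGL(3,k)` of the 21-point set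
`Z_C(α)` is the image in `PGL(3,k)` of the matrices with rows
`(a,b,0), (c,d,0), (a²c²α+e, b²d²α+f, 1)` where `a,…,f ∈ F₄` and `ad + bc = 1`;
in particular it has order 960. -/
theorem stabilizer_ZC (k : Type*) [Field k] [IsAlgClosed k] [CharP k 2]
    (ω : k) (hω : ω ^ 2 + ω + 1 = 0) (α : k)
    (h0 : α ≠ 0) (h1 : α ≠ 1) (h2 : α ≠ ω) (h3 : α ≠ ω + 1) :
    PGLstab k (ZCpts k ω α) =
      {x : PGL3 k | ∃ g : Matrix.GeneralLinearGroup (Fin 3) k,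
        (∃ a b c d e f : k,
          a ∈ ({0, 1, ω, ω + 1} : Set k) ∧ b ∈ ({0, 1, ω, ω + 1} : Set k) ∧
          c ∈ ({0, 1, ω, ω + 1} : Set k) ∧ d ∈ ({0, 1, ω, ω + 1} : Set k) ∧
          e ∈ ({0, 1, ω, ω + 1} : Set k) ∧ f ∈ ({0, 1, ω, ω + 1} : Set k) ∧
          a * d + b * c = 1 ∧
          (g : Matrix (Fin 3) (Fin 3) k) =
            !![a, b, 0; c, d, 0; a ^ 2 * c ^ 2 * α + e, b ^ 2 * d ^ 2 * α + f, 1]) ∧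
        QuotientGroup.mk g = x} ∧
    Nat.card (PGLstab k (ZCpts k ω α)) = 960 := by
  have hα : α ∉ fourSubfield k := by
    rw [mem_fourSubfield_iff hω]
    simp [h0, h1, h2, h3]
  have hstab : PGLstab k (ZCpts k ω α) = Set.range (stabPGL hω α) := by
    refine Set.Subset.antisymm (fun x hx => ?_) ?_
    · obtain ⟨g, rfl⟩ := QuotientGroup.mk_surjective x
      have hg := (actGL_image_ZCpts_eq_iff hω g).1 (hx g rfl)
      obtain ⟨r, hr, hfix⟩ := exists_mulVec_single_two_eq_smul hω hα hg
      obtain ⟨a, ha, b, hb, c, hc, d, hd, e, he, f, hf, hdet, hM⟩ :=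
        exists_eq_stabMatrix hα (M := r⁻¹ • (g : Matrix (Fin 3) (Fin 3) k))
          (fun v w hvw => by
            simp only [Matrix.smul_mulVec] at hvw
            exact Matrix.mulVec_injective_of_isUnit g.isUnit
              (smul_right_injective _ (inv_ne_zero hr) hvw))
          (fun v hv => by
            rw [Matrix.smul_mulVec]
            exact (hg v hv).smul (inv_ne_zero hr))
          (by rw [Matrix.smul_mulVec, hfix, inv_smul_smul₀ hr])
      rw [range_stabPGL]
      simp only [mem_fourSubfield_iff hω] at ha hb hc hd he hf
      refine ⟨stabGL α hdet e f, ⟨a, b, c, d, e, f, ha, hb, hc, hd, he, hf, hdet, rfl⟩, ?_⟩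
      refine mk_eq_mk_iff_exists_smul.2 ⟨r, hr, ?_⟩
      rw [coe_stabGL, ← hM, smul_inv_smul₀ hr]
    · rw [range_stabPGL]
      rintro x ⟨g, ⟨a, b, c, d, e, f, ha, hb, hc, hd, he, hf, hdet, hg⟩, rfl⟩ g' hg'
      simp only [← mem_fourSubfield_iff hω] at ha hb hc hd he hf
      obtain ⟨r, hr, hgg'⟩ := mk_eq_mk_iff_exists_smul.1 hg'.symm
      refine (actGL_image_ZCpts_eq_iff hω g').2 fun v hv => ?_
      rw [hgg', Matrix.smul_mulVec, hg]
      exact (hv.stabMatrix_mulVec ha hb hc hd he hf hdet).smul hr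
  refine ⟨hstab.trans (range_stabPGL hω α), ?_⟩
  rw [hstab, Nat.card_range_of_injective (stabPGL_injective hω α),
    card_stabIndex]
end

section
/- Let S be a set with 21 elements. Up to the natural action of the symmetric group of S, there is exactly one F₂-linear code C ⊆ Pow(S) of dimension 10 such that the full word S belongs to C and every word of C has weight in {0, 5, 8, 9, 12, 13, 16, 21}; moreover, for any bijection γ : S → P²(F₄), the code γ⁻¹(C_DK) is such a code. -/
/-- An `F`-rational line in the projective plane over `F`: the vanishing set of a nonzero
linear functional. -/
def IsProjLine (F : Type*) [Field F] (L : Set (Projectivization F (Fin 3 → F))) : Prop :=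
  ∃ φ : (Fin 3 → F) →ₗ[F] F, φ ≠ 0 ∧ L = {P | φ P.rep = 0}

/-- The Dolgachev–Kondō code `C_DK ⊆ Pow(P²(F₄))`: the `F₂`-linear span of the (indicator
functions of the) point sets of the `F₄`-rational lines. -/
noncomputable def CDK (F : Type*) [Field F] :
    Submodule (ZMod 2) (Projectivization F (Fin 3 → F) → ZMod 2) :=
  Submodule.span (ZMod 2)
    {w | ∃ L : Set (Projectivization F (Fin 3 → F)), IsProjLine F L ∧
      w = Set.indicator L (fun _ => (1 : ZMod 2))}

/-- The weight of a word `w ∈ Pow(S) = F₂^S`: the cardinality of its support. -/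
noncomputable def wt {S : Type*} (w : S → ZMod 2) : ℕ := {x | w x = 1}.ncard

/-- The condition of Theorem (ii): a code of dimension 10 containing the full word `S`,
all of whose words have weight in `{0, 5, 8, 9, 12, 13, 16, 21}`. -/
def GoodCode10 (S : Type*) (C : Submodule (ZMod 2) (S → ZMod 2)) : Prop :=
  Module.finrank (ZMod 2) C = 10 ∧ (fun _ => (1 : ZMod 2)) ∈ C ∧
    ∀ w ∈ C, wt w ∈ ({0, 5, 8, 9, 12, 13, 16, 21} : Set ℕ)

/-- A family of five-point subsets forming the lines of a projective plane of order four. -/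
structure IsPlane {S : Type*} (𝓛 : Set (Set S)) : Prop where
  ncard_eq : ∀ L ∈ 𝓛, L.ncard = 5
  join : ∀ p q, p ≠ q → ∃ L ∈ 𝓛, p ∈ L ∧ q ∈ L
  inter : ∀ L ∈ 𝓛, ∀ M ∈ 𝓛, L ≠ M → ∃ p, L ∩ M = {p}

/-- The nontrivial character of `ZMod 2` with values in `ℤ`. -/
def sign2 (a : ZMod 2) : ℤ := if a = 0 then 1 else -1

theorem sign2_add : ∀ a b, sign2 (a + b) = sign2 a * sign2 b := by decide

theorem sign2_mul_self : ∀ a, sign2 a * sign2 a = 1 := by decide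

theorem sum_eq_ite_of_map_add {V : Type*} [AddCommGroup V] [Fintype V] {χ : V → ℤ}
    (hχ : ∀ v w, χ (v + w) = χ v * χ w) [Decidable (∀ v, χ v = 1)] :
    ∑ v, χ v = if ∀ v, χ v = 1 then (Fintype.card V : ℤ) else 0 := by
  split_ifs with h
  · simp [h]
  · push Not at h
    obtain ⟨v, hv⟩ := h
    have h1 : ∑ w, χ w = χ v * ∑ w, χ w := by
      rw [Finset.mul_sum]
      simp only [← hχ]
      exact (Equiv.sum_comp (Equiv.addLeft v) χ).symm
    have h2 : (χ v - 1) * ∑ w, χ w = 0 := by linarith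
    exact (mul_eq_zero.1 h2).resolve_left (sub_ne_zero.2 hv)

section Weights

variable {S : Type*}

theorem wt_eq_card [Fintype S] (w : S → ZMod 2) :
    wt w = (Finset.univ.filter fun x => w x = 1).card := by
  rw [wt, ← Set.ncard_coe_finset]
  simp

theorem indicator_support_eq (w : S → ZMod 2) :
    Set.indicator {x | w x = 1} (fun _ => (1 : ZMod 2)) = w := by
  classical
  ext x
  have : ∀ a : ZMod 2, (if a = 1 then 1 else 0) = a := by decide
  simpa [Set.indicator_apply] using this (w x)

theorem setOf_indicator_eq (L : Set S) :
    {x | Set.indicator L (fun _ => (1 : ZMod 2)) x = 1} = L := by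
  ext x
  by_cases hx : x ∈ L <;> simp [hx]

theorem wt_indicator (L : Set S) : wt (Set.indicator L fun _ => (1 : ZMod 2)) = L.ncard := by
  rw [wt, setOf_indicator_eq]

variable [Fintype S]

theorem sum_sign2 (w : S → ZMod 2) : ∑ x, sign2 (w x) = Fintype.card S - 2 * wt w := by
  have h : ∀ a : ZMod 2, sign2 a = 1 - 2 * if a = 1 then 1 else 0 := by decide
  simp only [h, Finset.sum_sub_distrib, ← Finset.mul_sum, Finset.sum_boole, wt_eq_card]
  simp

theorem wt_one_add (w : S → ZMod 2) : wt ((fun _ => 1) + w) + wt w = Fintype.card S := by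
  have h : ∀ a : ZMod 2, 1 + a = 1 ↔ ¬ a = 1 := by decide
  rw [wt_eq_card, wt_eq_card, add_comm, ← Finset.card_univ]
  simp only [Pi.add_apply, h]
  exact Finset.card_filter_add_card_filter_not _

theorem wt_add [DecidableEq S] (v w : S → ZMod 2) :
    wt (v + w) + 2 * (Finset.univ.filter (fun x => v x = 1) ∩
      Finset.univ.filter fun x => w x = 1).card = wt v + wt w := by
  have h : ∀ a b : ZMod 2, (if a + b = 1 then 1 else 0) + 2 * (if a = 1 ∧ b = 1 then 1 else 0) =
    (if a = 1 then 1 else 0) + (if b = 1 then 1 else 0) := by decide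
  rw [← Finset.filter_and]
  simp only [wt_eq_card, Finset.card_filter, Finset.mul_sum, ← Finset.sum_add_distrib, Pi.add_apply]
  exact Finset.sum_congr rfl fun x _ => h _ _

end Weights

section Code

variable {S : Type*} {C : Submodule (ZMod 2) (S → ZMod 2)}

open Classical in
/-- The second and fourth moments of the weight distribution force at least `21` words of
weight `5`. -/
theorem le_card_wt_eq_five [Fintype S] (hC : GoodCode10 S C) (hS : Fintype.card S = 21) :
    21 ≤ (Finset.univ.filter fun w : C => wt w.1 = 5).card := by
  obtain ⟨hdim, hone, hwt⟩ := hC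
  have hcard : Fintype.card C = 1024 := by
    rw [Module.card_eq_pow_finrank (K := ZMod 2), hdim, ZMod.card]
    norm_num
  set χ : S × S → C → ℤ := fun p w => sign2 (w.1 p.1) * sign2 (w.1 p.2) with hχ
  set t : C → ℤ := fun w => ∑ x, sign2 (w.1 x) with ht
  have hχadd : ∀ p v w, χ p (v + w) = χ p v * χ p w := by
    intro p v w
    simp only [hχ, Submodule.coe_add, Pi.add_apply, sign2_add]
    ring
  have ht2 : ∀ w, t w ^ 2 = ∑ p, χ p w := by
    intro w
    rw [sq, ht, Finset.sum_mul_sum, Fintype.sum_prod_type]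
  set E : S × S → Prop := fun p => ∀ w, χ p w = 1 with hE
  set n : ℕ := (Finset.univ.filter E).card with hn
  have hM2 : ∑ w, t w ^ 2 = 1024 * n := by
    simp only [ht2]
    rw [Finset.sum_comm]
    simp only [sum_eq_ite_of_map_add (hχadd _), hcard, ← Finset.sum_filter]
    simp [hn, hE, mul_comm]
  have hn21 : 21 ≤ n := by
    rw [← hS, ← Finset.card_univ, ← Finset.diag_card, hn]
    refine Finset.card_le_card fun p hp => ?_
    simp only [Finset.mem_filter, Finset.mem_univ, true_and, hE, hχ]
    intro w
    rw [(Finset.mem_diag.1 hp).2, sign2_mul_self]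
  have hM (p q) : ∑ w, χ p w * χ q w = if ∀ w, χ p w * χ q w = 1 then 1024 else 0 := by
    rw [sum_eq_ite_of_map_add (fun v w => by rw [hχadd, hχadd]; ring), hcard]
    rfl
  have hrow : ∀ p, (if E p then 1024 * (n : ℤ) else 2048) ≤ ∑ w, χ p w * t w ^ 2 := by
    intro p
    split_ifs with hp
    · rw [← hM2]
      exact Finset.sum_le_sum fun w _ => by rw [hp w, one_mul]
    · simp only [ht2, Finset.mul_sum]
      rw [Finset.sum_comm]
      simp only [hM]
      have hne : p ≠ p.swap := by
        rintro h
        refine hp fun w => ?_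
        have : p.1 = p.2 := congrArg Prod.fst h
        simp only [hχ, this, sign2_mul_self]
      have h1 : ∀ w, χ p w * χ p w = 1 := fun w => by
        simp only [hχ]
        rw [mul_mul_mul_comm, sign2_mul_self, sign2_mul_self, one_mul]
      have h2 : ∀ w, χ p w * χ p.swap w = 1 := fun w => by
        rw [← h1 w]
        simp only [hχ, Prod.fst_swap, Prod.snd_swap]
        ring
      calc (2048 : ℤ) = ∑ q ∈ {p, p.swap}, if ∀ w, χ p w * χ q w = 1 then 1024 else 0 := by
            rw [Finset.sum_pair hne, if_pos h1, if_pos h2]; norm_num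
        _ ≤ _ := Finset.sum_le_sum_of_subset_of_nonneg (Finset.subset_univ _)
            fun q _ _ => by split_ifs <;> norm_num
  have hM4 : 1024 * (n : ℤ) * n + 2048 * (441 - n) ≤ ∑ w, t w ^ 4 := by
    have h4 : ∑ w, t w ^ 4 = ∑ p, ∑ w, χ p w * t w ^ 2 := by
      rw [Finset.sum_comm]
      refine Finset.sum_congr rfl fun w _ => ?_
      rw [← Finset.sum_mul, ← ht2]
      ring
    rw [h4]
    refine le_trans (le_of_eq ?_) (Finset.sum_le_sum fun p _ => hrow p)
    have hcompl := Finset.card_filter_add_card_filter_not (s := Finset.univ) E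
    rw [Finset.card_univ, Fintype.card_prod, hS] at hcompl
    rw [Finset.sum_ite, Finset.sum_const, Finset.sum_const, ← hn]
    rw [← hn] at hcompl
    simp only [nsmul_eq_mul]
    have : ((Finset.univ.filter fun p => ¬ E p).card : ℤ) = 441 - n := by omega
    rw [this]
    ring
  have hval : ∀ w : C, (t w ^ 2 - 25) * (t w ^ 2 - 9) =
      (if wt w.1 = 0 then 179712 else 0) + (if wt w.1 = 21 then 179712 else 0) +
      (if wt w.1 = 5 then 10752 else 0) + (if wt w.1 = 16 then 10752 else 0) := by
    intro w
    have h1 : t w = 21 - 2 * wt w.1 := by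
      simp only [ht, sum_sign2, hS]
      norm_num
    have h2 := hwt w.1 w.2
    simp only [Set.mem_insert_iff, Set.mem_singleton_iff] at h2
    rw [h1]
    rcases h2 with h | h | h | h | h | h | h | h <;> simp [h]
  let compl : C → C := fun w => ⟨(fun _ => 1) + w.1, C.add_mem hone w.2⟩
  have compl_inj : Function.Injective compl := fun v w h => by
    exact Subtype.ext (add_left_cancel (congrArg Subtype.val h))
  have compl_wt : ∀ w : C, wt (compl w).1 + wt w.1 = 21 := fun w => by
    rw [← hS]; exact wt_one_add _
  have hle : ∀ i j, i + j = 21 → (Finset.univ.filter fun w : C => wt w.1 = i).card ≤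
      (Finset.univ.filter fun w : C => wt w.1 = j).card := by
    intro i j hij
    refine Finset.card_le_card_of_injOn compl (fun w hw => ?_) compl_inj.injOn
    have := compl_wt w
    simp only [Finset.coe_filter, Finset.mem_univ, true_and, Set.mem_ofPred_eq] at hw ⊢
    omega
  have hzero : (Finset.univ.filter fun w : C => wt w.1 = 0).card ≤ 1 := by
    refine Finset.card_le_one.2 fun v hv w hw => ?_
    have key : ∀ w : C, wt w.1 = 0 → w = 0 := fun w hw => by
      rw [wt, Set.ncard_eq_zero] at hw
      rw [← Subtype.coe_inj, ← indicator_support_eq w.1, hw, Set.indicator_empty]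
      rfl
    rw [key v (Finset.mem_filter.1 hv).2, key w (Finset.mem_filter.1 hw).2]
  have h21 := hle 21 0 rfl
  have h16 := hle 16 5 rfl
  have hsum : ∑ w, t w ^ 4 - 34 * ∑ w, t w ^ 2 + 225 * 1024 =
      ∑ w, (t w ^ 2 - 25) * (t w ^ 2 - 9) := by
    have : (225 * 1024 : ℤ) = ∑ _w : C, 225 := by
      rw [Finset.sum_const, Finset.card_univ, hcard]
      rfl
    rw [this, Finset.mul_sum, ← Finset.sum_sub_distrib, ← Finset.sum_add_distrib]
    exact Finset.sum_congr rfl fun w _ => by ring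
  simp only [hval, Finset.sum_add_distrib, ← Finset.sum_filter, Finset.sum_const,
    nsmul_eq_mul] at hsum
  rw [hM2] at hsum
  generalize (Finset.univ.filter fun w : C => wt w.1 = 0).card = a₀ at *
  generalize (Finset.univ.filter fun w : C => wt w.1 = 5).card = a₅ at *
  generalize (Finset.univ.filter fun w : C => wt w.1 = 16).card = a₁₆ at *
  generalize (Finset.univ.filter fun w : C => wt w.1 = 21).card = a₂₁ at *
  zify at h21 h16 hzero hn21 ⊢
  nlinarith

theorem GoodCode10.isPlane (hC : GoodCode10 S C) (hS : Nat.card S = 21) :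
    IsPlane {L : Set S | Set.indicator L (fun _ => (1 : ZMod 2)) ∈ C ∧ L.ncard = 5} := by
  classical
  have : Finite S := Nat.finite_of_card_ne_zero (by omega)
  have := Fintype.ofFinite S
  rw [Nat.card_eq_fintype_card] at hS
  let supp : (S → ZMod 2) → Finset S := fun w => Finset.univ.filter fun x => w x = 1
  have supp_coe : ∀ L : Set S, (supp (Set.indicator L fun _ => 1) : Set S) = L := fun L => by
    simp only [supp, Finset.coe_filter, Finset.mem_univ, true_and]
    exact setOf_indicator_eq L
  have hinter : ∀ v ∈ C, ∀ w ∈ C, wt v = 5 → wt w = 5 → v ≠ w → (supp v ∩ supp w).card = 1 := by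
    intro v hv w hw hv5 hw5 hne
    have h1 := wt_add v w
    have h2 := hC.2.2 _ (C.add_mem hv hw)
    have h3 : wt (v + w) ≠ 0 := fun h => hne <| by
      rw [wt, Set.ncard_eq_zero] at h
      have h4 := indicator_support_eq (v + w)
      rw [h, Set.indicator_empty] at h4
      have h5 : v + w = 0 := h4.symm
      ext x
      have : ∀ a b : ZMod 2, a + b = 0 → a = b := by decide
      exact this _ _ (congrFun h5 x)
    simp only [Set.mem_insert_iff, Set.mem_singleton_iff] at h2
    simp only [supp]
    omega
  refine ⟨fun L hL => hL.2, fun p q hpq => ?_, fun L hL M hM hLM => ?_⟩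
  · let W : Finset C := Finset.univ.filter fun w : C => wt w.1 = 5
    have hW : 21 ≤ W.card := le_card_wt_eq_five hC hS
    have hdisj : (W : Set C).PairwiseDisjoint fun w => (supp w.1).offDiag := by
      intro v hv w hw hne
      refine Finset.disjoint_left.2 fun x hxv hxw => ?_
      have hv5 := (Finset.mem_filter.1 hv).2
      have hw5 := (Finset.mem_filter.1 hw).2
      have h1 := hinter v.1 v.2 w.1 w.2 hv5 hw5 (Subtype.coe_injective.ne hne)
      rw [Finset.mem_offDiag] at hxv hxw
      exact hxv.2.2 (Finset.card_le_one.1 h1.le _ (Finset.mem_inter.2 ⟨hxv.1, hxw.1⟩) _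
        (Finset.mem_inter.2 ⟨hxv.2.1, hxw.2.1⟩))
    have hcard : (W.biUnion fun w => (supp w.1).offDiag).card = W.card * 20 := by
      rw [Finset.card_biUnion hdisj, ← smul_eq_mul, ← Finset.sum_const]
      refine Finset.sum_congr rfl fun w hw => ?_
      rw [Finset.offDiag_card, ← wt_eq_card, (Finset.mem_filter.1 hw).2]
    have huniv : (W.biUnion fun w => (supp w.1).offDiag) = Finset.univ.offDiag := by
      refine Finset.eq_of_subset_of_card_le ?_ ?_
      · exact Finset.biUnion_subset.2 fun w _ => Finset.offDiag_mono (Finset.subset_univ _)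
      · rw [hcard, Finset.offDiag_card, Finset.card_univ, hS]
        omega
    have hmem : (p, q) ∈ W.biUnion fun w => (supp w.1).offDiag := by
      rw [huniv]
      simpa using hpq
    obtain ⟨w, hw, hpqw⟩ := Finset.mem_biUnion.1 hmem
    simp only [supp, Finset.mem_offDiag, Finset.mem_filter, Finset.mem_univ, true_and] at hpqw
    refine ⟨{x | w.1 x = 1}, ⟨?_, (Finset.mem_filter.1 hw).2⟩, hpqw.1, hpqw.2.1⟩
    rw [indicator_support_eq]
    exact w.2
  · have h1 := hinter _ hL.1 _ hM.1 (by rw [wt_indicator, hL.2]) (by rw [wt_indicator, hM.2])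
      fun h => hLM (by rw [← setOf_indicator_eq L, h, setOf_indicator_eq])
    obtain ⟨p, hp⟩ := Finset.card_eq_one.1 h1
    refine ⟨p, ?_⟩
    rw [← supp_coe L, ← supp_coe M, ← Finset.coe_inter, hp, Finset.coe_singleton]

end Code

/-- Two rows of a square without a common entry in any column. -/
def RowsDisjoint (r s : Fin 4 → Fin 4) : Prop := ∀ j, r j ≠ s j

/-- No pair of entries is repeated between the rows `(r, s)` and `(r', s')` of two superimposed
squares. -/
def RowsOrthogonal (r s r' s' : Fin 4 → Fin 4) : Prop := ∀ j k, r j = r' k → s j ≠ s' k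

instance (r s : Fin 4 → Fin 4) : Decidable (RowsDisjoint r s) :=
  inferInstanceAs (Decidable (∀ j, r j ≠ s j))

instance (r s r' s' : Fin 4 → Fin 4) : Decidable (RowsOrthogonal r s r' s') :=
  inferInstanceAs (Decidable (∀ j k, r j = r' k → s j ≠ s' k))

/-- The addition table of the field with four elements. -/
def xorTable : Fin 4 → Fin 4 → Fin 4 :=
  ![![0, 1, 2, 3], ![1, 0, 3, 2], ![2, 3, 0, 1], ![3, 2, 1, 0]]

/-- The table of `(x, y) ↦ ω x + y` over the field with four elements. -/
def omegaTable : Fin 4 → Fin 4 → Fin 4 :=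
  ![![0, 1, 2, 3], ![2, 3, 0, 1], ![3, 2, 1, 0], ![1, 0, 3, 2]]

/-- The table of `(x, y) ↦ ω² x + y` over the field with four elements. -/
def omegaSqTable : Fin 4 → Fin 4 → Fin 4 :=
  ![![0, 1, 2, 3], ![3, 2, 1, 0], ![1, 0, 3, 2], ![2, 3, 0, 1]]

set_option synthInstance.maxHeartbeats 0 in
set_option synthInstance.maxSize 100000 in
set_option maxRecDepth 100000 in
theorem eq_tables_of_orthogonal :
    ∀ a₁ : Fin 4 → Fin 4, a₁ 0 = 1 → a₁.Injective → RowsDisjoint id a₁ →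
    ∀ a₂ : Fin 4 → Fin 4, a₂ 0 = 2 → a₂.Injective → RowsDisjoint id a₂ → RowsDisjoint a₁ a₂ →
    ∀ a₃ : Fin 4 → Fin 4, a₃ 0 = 3 → a₃.Injective → RowsDisjoint id a₃ → RowsDisjoint a₁ a₃ →
      RowsDisjoint a₂ a₃ →
    ∀ b₁ : Fin 4 → Fin 4, b₁.Injective → RowsDisjoint id b₁ → RowsOrthogonal id id a₁ b₁ →
    ∀ b₂ : Fin 4 → Fin 4, b₂.Injective → RowsDisjoint id b₂ → RowsDisjoint b₁ b₂ →
      RowsOrthogonal id id a₂ b₂ → RowsOrthogonal a₁ b₁ a₂ b₂ →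
    ∀ b₃ : Fin 4 → Fin 4, b₃.Injective → RowsDisjoint id b₃ → RowsDisjoint b₁ b₃ →
      RowsDisjoint b₂ b₃ → RowsOrthogonal id id a₃ b₃ → RowsOrthogonal a₁ b₁ a₃ b₃ →
      RowsOrthogonal a₂ b₂ a₃ b₃ →
      (a₁ = xorTable 1 ∧ a₂ = xorTable 2 ∧ a₃ = xorTable 3) ∧
      ((b₁ = omegaTable 1 ∧ b₂ = omegaTable 2 ∧ b₃ = omegaTable 3) ∨
        (b₁ = omegaSqTable 1 ∧ b₂ = omegaSqTable 2 ∧ b₃ = omegaSqTable 3)) := by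
  decide +kernel

/-- The points of the standard plane: sixteen affine points and five points at infinity. -/
abbrev StdPoint := (Fin 4 × Fin 4) ⊕ Fin 5

/-- A numbering of the points of the standard plane by `0, …, 20`. -/
def pointIndex : StdPoint → ℕ := Sum.elim (fun p => 4 * p.1 + p.2) (fun z => 16 + z)

/-- `stdCoord z p` tells which affine line through the point `z` at infinity contains `p`. -/
def stdCoord : Fin 5 → Fin 4 × Fin 4 → Fin 4 :=
  ![fun p => p.1, fun p => p.2, fun p => xorTable p.1 p.2,
    fun p => omegaTable p.1 p.2, fun p => omegaSqTable p.1 p.2]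

/-- Incidence in the standard plane; `none` is the line at infinity. -/
def stdInc : Option (Fin 5 × Fin 4) → StdPoint → Bool
  | none, Sum.inl _ => false
  | none, Sum.inr _ => true
  | some (z, k), Sum.inl p => stdCoord z p == k
  | some (z, _), Sum.inr w => w == z

/-- The points `Z z` form a line, and `f z` numbers the other lines through `Z z`. -/
structure IsCoord {S : Type*} (𝓛 : Set (Set S)) (Z : Fin 5 → S) (f : Fin 5 → S → Fin 4) :
    Prop where
  range_mem : Set.range Z ∈ 𝓛
  injective : Z.Injective
  line_mem : ∀ z k, insert (Z z) {p | p ∉ Set.range Z ∧ f z p = k} ∈ 𝓛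
  existsUnique : ∀ z w, z ≠ w → ∀ i j, ∃! p, p ∉ Set.range Z ∧ f z p = i ∧ f w p = j

section Plane

variable {S : Type*} {𝓛 : Set (Set S)} {Z : Fin 5 → S} {f : Fin 5 → S → Fin 4}

theorem IsPlane.point_eq (h : IsPlane 𝓛) {L M : Set S} (hL : L ∈ 𝓛) (hM : M ∈ 𝓛) (hne : L ≠ M)
    {p q : S} (hpL : p ∈ L) (hpM : p ∈ M) (hqL : q ∈ L) (hqM : q ∈ M) : p = q := by
  obtain ⟨r, hr⟩ := h.inter L hL M hM hne
  have hp : p ∈ L ∩ M := ⟨hpL, hpM⟩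
  have hq : q ∈ L ∩ M := ⟨hqL, hqM⟩
  rw [hr] at hp hq
  exact hp.trans hq.symm

theorem IsPlane.line_eq (h : IsPlane 𝓛) {L M : Set S} (hL : L ∈ 𝓛) (hM : M ∈ 𝓛) {p q : S}
    (hne : p ≠ q) (hpL : p ∈ L) (hpM : p ∈ M) (hqL : q ∈ L) (hqM : q ∈ M) : L = M := by
  by_contra hLM
  exact hne (h.point_eq hL hM hLM hpL hpM hqL hqM)

theorem IsPlane.exists_ne (h : IsPlane 𝓛) {L : Set S} (hL : L ∈ 𝓛) (p : S) :
    ∃ q ∈ L, q ≠ p :=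
  Set.exists_ne_of_one_lt_ncard (by rw [h.ncard_eq L hL]; norm_num) p

theorem IsPlane.exists_pencil (h : IsPlane 𝓛) {L : Set S} (hL : L ∈ 𝓛) {x o : S} (hx : x ∈ L)
    (ho : o ∉ L) : ∃ g : S → Fin 4, ∀ k, insert x {p | p ∉ L ∧ g p = k} ∈ 𝓛 := by
  obtain ⟨y, hy, hyx⟩ := h.exists_ne hL x
  have hyo : y ≠ o := fun e => ho (e ▸ hy)
  obtain ⟨M, hM, hyM, hoM⟩ := h.join y o hyo
  have hML : M ≠ L := fun e => ho (e ▸ hoM)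
  have hxM : x ∉ M := fun hxM => hyx (h.point_eq hM hL hML hyM hy hxM hx)
  have hcard : Nat.card ↥(M \ {y}) = 4 := by
    rw [Nat.card_coe_set_eq, Set.ncard_sdiff_singleton_of_mem hyM, h.ncard_eq M hM]
  have hfin : Finite ↥(M \ {y}) := Nat.finite_of_card_ne_zero (by omega)
  have u : Fin 4 ≃ ↥(M \ {y}) := (Finite.equivFinOfCardEq hcard).symm
  have huM : ∀ k, (u k : S) ∈ M := fun k => (u k).2.1
  have huL : ∀ k, (u k : S) ∉ L := fun k hk =>
    (u k).2.2 (h.point_eq hM hL hML (huM k) hk hyM hy)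
  have key : ∀ p, ∃ k, p ∉ L → ∃ K ∈ 𝓛, x ∈ K ∧ p ∈ K ∧ (u k : S) ∈ K := by
    intro p
    by_cases hp : p ∈ L
    · exact ⟨0, fun h => absurd hp h⟩
    obtain ⟨K, hK, hxK, hpK⟩ := h.join x p fun e => hp (e ▸ hx)
    have hKM : K ≠ M := fun e => hxM (e ▸ hxK)
    obtain ⟨q, hq⟩ := h.inter K hK M hM hKM
    have hqK : q ∈ K ∩ M := by rw [hq]; rfl
    have hqy : q ≠ y := by
      rintro rfl
      exact hp (h.line_eq hK hL hyx hqK.1 hy hxK hx ▸ hpK)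
    refine ⟨u.symm ⟨q, hqK.2, hqy⟩, fun _ => ⟨K, hK, hxK, hpK, ?_⟩⟩
    simpa using hqK.1
  choose g hg using key
  refine ⟨g, fun k => ?_⟩
  have hxu : ∀ k, x ≠ u k := fun k e => huL k (e ▸ hx)
  obtain ⟨K, hK, hxK, huK⟩ := h.join x (u k) (hxu k)
  have hKM : K ≠ M := fun e => hxM (e ▸ hxK)
  convert hK using 1
  ext q
  simp only [Set.mem_insert_iff, Set.mem_ofPred_eq]
  constructor
  · rintro (rfl | ⟨hqL, rfl⟩)
    · exact hxK
    · obtain ⟨K', hK', hxK', hqK', huK'⟩ := hg q hqL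
      rwa [h.line_eq hK hK' (hxu _) hxK hxK' huK huK']
  · intro hqK
    by_cases hqx : q = x
    · exact Or.inl hqx
    have hqL : q ∉ L := fun hqL => huL k (h.line_eq hK hL hqx hqK hqL hxK hx ▸ huK)
    refine Or.inr ⟨hqL, ?_⟩
    obtain ⟨K', hK', hxK', hqK', huK'⟩ := hg q hqL
    rw [h.line_eq hK' hK hqx hqK' hqK hxK' hxK] at huK'
    exact u.injective (Subtype.ext (h.point_eq hK hM hKM huK' (huM _) huK (huM _)))

theorem IsPlane.exists_isCoord (h : IsPlane 𝓛) (hS : Nat.card S = 21) :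
    ∃ Z f, IsCoord 𝓛 Z f := by
  have hfin : Finite S := Nat.finite_of_card_ne_zero (by omega)
  have hnt : Nontrivial S := (Finite.one_lt_card_iff_nontrivial).1 (by omega)
  obtain ⟨p, q, hpq⟩ := exists_pair_ne S
  obtain ⟨L, hL, -, -⟩ := h.join p q hpq
  obtain ⟨o, ho⟩ : ∃ o, o ∉ L := by
    by_contra! hall
    have := h.ncard_eq L hL
    rw [Set.eq_univ_of_forall hall, Set.ncard_univ] at this
    omega
  have e : Fin 5 ≃ L := (Finite.equivFinOfCardEq (h.ncard_eq L hL)).symm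
  have hrange : Set.range (fun z => (e z : S)) = L := by
    rw [← Function.comp_def, Set.range_comp, e.range_eq_univ, Set.image_univ, Subtype.range_coe]
  choose f hf using fun z => h.exists_pencil hL (e z).2 ho
  have hinj : Function.Injective fun z => (e z : S) := Subtype.val_injective.comp e.injective
  refine ⟨fun z => e z, f, by rwa [hrange], hinj, by rwa [hrange], ?_⟩
  rw [hrange]
  intro z w hzw i j
  have hne : (e z : S) ≠ e w := hinj.ne hzw
  obtain ⟨p, hp⟩ := h.inter _ (hf z i) _ (hf w j) fun e' => by
    have : (e w : S) ∈ insert (e z : S) {p | p ∉ L ∧ f z p = i} := by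
      rw [e']; exact Set.mem_insert _ _
    rcases this with h1 | h1
    · exact hne h1.symm
    · exact h1.1 (e w).2
  have hp' : p ∈ insert (e z : S) {p | p ∉ L ∧ f z p = i} ∩
    insert (e w : S) {p | p ∉ L ∧ f w p = j} := by rw [hp]; rfl
  have hez := (e z).2
  have hew := (e w).2
  refine ⟨p, ?_, fun q hq => ?_⟩
  · obtain ⟨h1 | h1, h2 | h2⟩ := hp'
    · exact absurd (h1.symm.trans h2) hne
    · exact absurd (h1 ▸ hez) h2.1
    · exact absurd (h2 ▸ hew) h1.1
    · exact ⟨h1.1, h1.2, h2.2⟩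
  · have : q ∈ ({p} : Set S) := by
      rw [← hp]
      exact ⟨Or.inr ⟨hq.1, hq.2.1⟩, Or.inr ⟨hq.1, hq.2.2⟩⟩
    exact this

theorem IsCoord.relabel (h : IsCoord 𝓛 Z f) (π : Fin 5 → Equiv.Perm (Fin 4)) :
    IsCoord 𝓛 Z fun z p => π z (f z p) where
  range_mem := h.range_mem
  injective := h.injective
  line_mem z k := by simpa [← Equiv.eq_symm_apply] using h.line_mem z ((π z).symm k)
  existsUnique z w hzw i j := by
    simpa [← Equiv.eq_symm_apply] using h.existsUnique z w hzw ((π z).symm i) ((π w).symm j)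

theorem IsCoord.reindex (h : IsCoord 𝓛 Z f) (τ : Equiv.Perm (Fin 5)) :
    IsCoord 𝓛 (Z ∘ τ) (f ∘ τ) where
  range_mem := by rw [τ.surjective.range_comp]; exact h.range_mem
  injective := h.injective.comp τ.injective
  line_mem z k := by rw [τ.surjective.range_comp]; exact h.line_mem (τ z) k
  existsUnique z w hzw i j := by
    rw [τ.surjective.range_comp]
    exact h.existsUnique (τ z) (τ w) (τ.injective.ne hzw) i j

theorem IsCoord.exists_perm (h : IsCoord 𝓛 Z f) {z w x : Fin 5} (hzw : z ≠ w) (hzx : z ≠ x)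
    (i : Fin 4) :
    ∃ ρ : Equiv.Perm (Fin 4), ∀ p, p ∉ Set.range Z → f z p = i → ρ (f w p) = f x p := by
  choose P hP hP' using h.existsUnique z w hzw i
  have hinj : Function.Injective fun j => f x (P j) := by
    intro j k hjk
    have := (h.existsUnique z x hzx i (f x (P k))).unique
      ⟨(hP j).1, (hP j).2.1, hjk⟩ ⟨(hP k).1, (hP k).2.1, rfl⟩
    rw [← (hP j).2.2, ← (hP k).2.2, this]
  refine ⟨Equiv.ofBijective _ (Finite.injective_iff_bijective.1 hinj), fun p hp hi => ?_⟩
  simp only [Equiv.ofBijective_apply]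
  rw [← hP' _ p ⟨hp, hi, rfl⟩]

theorem IsCoord.exists_normalized (h : IsCoord 𝓛 Z f) : ∃ f', IsCoord 𝓛 Z f' ∧
    (∀ p, p ∉ Set.range Z → f' 0 p = 0 → ∀ z, z ≠ 0 → f' z p = f' 1 p) ∧
    ∀ p, p ∉ Set.range Z → f' 1 p = 0 → f' 0 p = f' 2 p := by
  have h1 : ∀ z, ∃ ρ : Equiv.Perm (Fin 4), z ≠ 0 →
      ∀ p, p ∉ Set.range Z → f 0 p = 0 → ρ (f z p) = f 1 p := by
    intro z
    by_cases hz : z = 0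
    · exact ⟨1, fun h => absurd hz h⟩
    · obtain ⟨ρ, hρ⟩ := h.exists_perm (Ne.symm hz) (zero_ne_one) 0
      exact ⟨ρ, fun _ => hρ⟩
  choose ρ hρ using h1
  obtain ⟨f₁, hf₁, h₁⟩ : ∃ f', IsCoord 𝓛 Z f' ∧
      ∀ p, p ∉ Set.range Z → f' 0 p = 0 → ∀ z, z ≠ 0 → f' z p = f' 1 p := by
    refine ⟨_, h.relabel fun z => if z = 0 then 1 else ρ z, fun p hp h0 z hz => ?_⟩
    simp only [if_true, Equiv.Perm.one_apply] at h0
    simp only [if_neg hz, one_ne_zero, if_false]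
    rw [hρ z hz p hp h0, hρ 1 one_ne_zero p hp h0]
  obtain ⟨σ, hσ⟩ := hf₁.exists_perm (z := 1) (w := 0) (x := 2) (by decide) (by decide) 0
  have hσ0 : σ 0 = 0 := by
    obtain ⟨p, ⟨hp, h0, h1⟩, -⟩ := hf₁.existsUnique 0 1 (by decide) 0 0
    have := hσ p hp h1
    rwa [h0, h₁ p hp h0 2 (by decide), h1] at this
  refine ⟨_, hf₁.relabel fun z => if z = 0 then σ else 1, fun p hp h0 z hz => ?_, fun p hp h1 => ?_⟩
  · simp only [if_true] at h0
    simp only [if_neg hz, one_ne_zero, if_false, Equiv.Perm.one_apply]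
    refine h₁ p hp (σ.injective ?_) z hz
    rw [h0, hσ0]
  · simp only [one_ne_zero, if_false, Equiv.Perm.one_apply] at h1
    have h2 : (2 : Fin 5) ≠ 0 := by decide
    simp only [if_true, if_neg h2, Equiv.Perm.one_apply]
    exact hσ p hp h1

theorem IsCoord.exists_standard (h : IsCoord 𝓛 Z f) : ∃ Z' f', IsCoord 𝓛 Z' f' ∧
    ∀ p, p ∉ Set.range Z' → ∀ z, f' z p = stdCoord z (f' 0 p, f' 1 p) := by
  obtain ⟨f, h, h0, h1⟩ := h.exists_normalized
  choose P hP hP' using h.existsUnique 0 1 (by decide)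
  have inj : ∀ {z w}, z ≠ w → ∀ {i j i' j'}, f z (P i j) = f z (P i' j') →
      f w (P i j) = f w (P i' j') → i = i' ∧ j = j' := by
    intro z w hzw i j i' j' hz hw
    have := (h.existsUnique z w hzw _ _).unique ⟨(hP i j).1, hz, hw⟩ ⟨(hP i' j').1, rfl, rfl⟩
    constructor
    · rw [← (hP i j).2.1, ← (hP i' j').2.1, this]
    · rw [← (hP i j).2.2, ← (hP i' j').2.2, this]
  have rowInj : ∀ z i, z ≠ 0 → Function.Injective fun j => f z (P i j) := fun z i hz j j' hj =>
    (inj hz hj (by rw [(hP _ _).2.1, (hP _ _).2.1])).2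
  have rowDisj : ∀ z i i', z ≠ 1 → i ≠ i' →
      RowsDisjoint (fun j => f z (P i j)) (fun j => f z (P i' j)) := fun z i i' hz hi j hj =>
    hi (inj hz hj (by rw [(hP _ _).2.2, (hP _ _).2.2])).1
  have rowOrth : ∀ z w i i', z ≠ w → i ≠ i' →
      RowsOrthogonal (fun j => f z (P i j)) (fun j => f w (P i j)) (fun j => f z (P i' j))
        (fun j => f w (P i' j)) := fun z w i i' hz hi j k hj hk => hi (inj hz hj hk).1
  have row0 : ∀ z, z ≠ 0 → (fun j => f z (P 0 j)) = id := fun z hz => funext fun j => by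
    rw [h0 _ (hP 0 j).1 (hP 0 j).2.1 z hz, (hP 0 j).2.2, id]
  have col0 : ∀ i, f 2 (P i 0) = i := fun i => by
    rw [← h1 _ (hP i 0).1 (hP i 0).2.2, (hP i 0).2.1]
  have tables : ∀ w, w ≠ 0 → w ≠ 1 → w ≠ 2 → (∀ i j, f 2 (P i j) = xorTable i j) ∧
      ((∀ i j, f w (P i j) = omegaTable i j) ∨ (∀ i j, f w (P i j) = omegaSqTable i j)) := by
    intro w hw0 hw1 hw2
    have hD2 := fun i hi => row0 2 (by decide) ▸ rowDisj 2 0 i (by decide) hi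
    have hDw := fun i hi => row0 w hw0 ▸ rowDisj w 0 i hw1 hi
    have hO := fun i hi => row0 2 (by decide) ▸ row0 w hw0 ▸ rowOrth 2 w 0 i hw2.symm hi
    obtain ⟨⟨a1, a2, a3⟩, hb⟩ := eq_tables_of_orthogonal
      _ (col0 1) (rowInj 2 1 (by decide)) (hD2 1 (by decide))
      _ (col0 2) (rowInj 2 2 (by decide)) (hD2 2 (by decide))
      (rowDisj 2 1 2 (by decide) (by decide))
      _ (col0 3) (rowInj 2 3 (by decide)) (hD2 3 (by decide))
      (rowDisj 2 1 3 (by decide) (by decide)) (rowDisj 2 2 3 (by decide) (by decide))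
      _ (rowInj w 1 hw0) (hDw 1 (by decide)) (hO 1 (by decide))
      _ (rowInj w 2 hw0) (hDw 2 (by decide)) (rowDisj w 1 2 hw1 (by decide)) (hO 2 (by decide))
      (rowOrth 2 w 1 2 hw2.symm (by decide))
      _ (rowInj w 3 hw0) (hDw 3 (by decide)) (rowDisj w 1 3 hw1 (by decide))
      (rowDisj w 2 3 hw1 (by decide)) (hO 3 (by decide))
      (rowOrth 2 w 1 3 hw2.symm (by decide)) (rowOrth 2 w 2 3 hw2.symm (by decide))
    have combine : ∀ (z : Fin 5) (t : Fin 4 → Fin 4 → Fin 4), z ≠ 0 → t 0 = id →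
        (fun j => f z (P 1 j)) = t 1 → (fun j => f z (P 2 j)) = t 2 →
        (fun j => f z (P 3 j)) = t 3 → ∀ i j, f z (P i j) = t i j := by
      intro z t hz t0 t1 t2 t3 i j
      fin_cases i
      · exact congrFun ((row0 z hz).trans t0.symm) j
      · exact congrFun t1 j
      · exact congrFun t2 j
      · exact congrFun t3 j
    refine ⟨combine 2 _ (by decide) (by decide) a1 a2 a3, ?_⟩
    rcases hb with ⟨b1, b2, b3⟩ | ⟨b1, b2, b3⟩
    · exact Or.inl (combine w _ hw0 (by decide) b1 b2 b3)
    · exact Or.inr (combine w _ hw0 (by decide) b1 b2 b3)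
  have hpoint : ∀ p, p ∉ Set.range Z → P (f 0 p) (f 1 p) = p := fun p hp =>
    (hP' _ _ p ⟨hp, rfl, rfl⟩).symm
  obtain ⟨hA, h3⟩ := tables 3 (by decide) (by decide) (by decide)
  obtain ⟨-, h4⟩ := tables 4 (by decide) (by decide) (by decide)
  have hne : ∀ t : Fin 4 → Fin 4 → Fin 4, t 1 0 = t 0 (t 1 0) →
      (∀ i j, f 3 (P i j) = t i j) → (∀ i j, f 4 (P i j) = t i j) → False := by
    intro t ht h3 h4
    have := inj (show (3 : Fin 5) ≠ 4 by decide) (i := 1) (j := 0) (i' := 0) (j' := t 1 0)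
      (by rw [h3, h3, ← ht]) (by rw [h4, h4, ← ht])
    exact absurd this.1 (by decide)
  rcases h3 with h3 | h3 <;> rcases h4 with h4 | h4
  · exact (hne _ (by decide) h3 h4).elim
  · refine ⟨Z, f, h, fun p hp z => ?_⟩
    rw [← hpoint p hp]
    fin_cases z
    all_goals simp [stdCoord, hA, h3, h4, hP]
  · refine ⟨_, _, h.reindex (Equiv.swap 3 4), fun p hp z => ?_⟩
    rw [(Equiv.swap (3 : Fin 5) 4).surjective.range_comp] at hp
    rw [← hpoint p hp]
    have e0 : Equiv.swap (3 : Fin 5) 4 0 = 0 := by decide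
    have e1 : Equiv.swap (3 : Fin 5) 4 1 = 1 := by decide
    have e2 : Equiv.swap (3 : Fin 5) 4 2 = 2 := by decide
    fin_cases z
    all_goals simp [stdCoord, hA, h3, h4, hP, e0, e1, e2]
  · exact (hne _ (by decide) h3 h4).elim

theorem exists_stdInc : ∀ t t' : StdPoint, ∃ l, stdInc l t ∧ stdInc l t' := by
  decide +kernel

theorem IsPlane.exists_equiv (h : IsPlane 𝓛) (hS : Nat.card S = 21) :
    ∃ e : StdPoint ≃ S, 𝓛 = Set.range fun l => e '' {t | stdInc l t} := by
  obtain ⟨Z, f, hf⟩ := h.exists_isCoord hS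
  obtain ⟨Z, f, hf, hstd⟩ := hf.exists_standard
  choose P hP hP' using hf.existsUnique 0 1 (by decide)
  have hpoint : ∀ p, p ∉ Set.range Z → P (f 0 p) (f 1 p) = p := fun p hp =>
    (hP' _ _ p ⟨hp, rfl, rfl⟩).symm
  have hbij : Function.Bijective (Sum.elim (fun p : Fin 4 × Fin 4 => P p.1 p.2) Z) := by
    constructor
    · refine Function.Injective.sumElim ?_ hf.injective fun p z hpz =>
        (hP p.1 p.2).1 ⟨z, hpz.symm⟩
      rintro ⟨i, j⟩ ⟨i', j'⟩ (hij : P i j = P i' j')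
      have h01 := (hP i j).2
      rw [hij] at h01
      exact Prod.ext (h01.1.symm.trans (hP i' j').2.1) (h01.2.symm.trans (hP i' j').2.2)
    · intro s
      by_cases hs : s ∈ Set.range Z
      · obtain ⟨z, rfl⟩ := hs
        exact ⟨Sum.inr z, rfl⟩
      · exact ⟨Sum.inl (f 0 s, f 1 s), hpoint s hs⟩
  refine ⟨Equiv.ofBijective _ hbij, ?_⟩
  have hmem : ∀ l, Equiv.ofBijective _ hbij '' {t | stdInc l t} ∈ 𝓛 := by
    rintro (- | ⟨z, k⟩)
    · convert hf.range_mem using 1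
      ext s
      simp [stdInc]
    · convert hf.line_mem z k using 1
      ext s
      simp only [Set.mem_image, Set.mem_ofPred_eq, Sum.exists, Set.mem_insert_iff,
        Equiv.ofBijective_apply, Sum.elim_inl, Sum.elim_inr, stdInc, beq_iff_eq]
      constructor
      · rintro (⟨⟨i, j⟩, hk, rfl⟩ | ⟨w, rfl, rfl⟩)
        · refine Or.inr ⟨(hP i j).1, ?_⟩
          rw [hstd _ (hP i j).1, (hP i j).2.1, (hP i j).2.2, hk]
        · exact Or.inl rfl
      · rintro (rfl | ⟨hs, rfl⟩)
        · exact Or.inr ⟨z, rfl, rfl⟩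
        · exact Or.inl ⟨(f 0 s, f 1 s), (hstd s hs z).symm, hpoint s hs⟩
  refine Set.Subset.antisymm (fun L hL => ?_) (Set.range_subset_iff.2 hmem)
  obtain ⟨p, q, hp, hq, hpq⟩ := (Set.one_lt_ncard_iff
    (Set.finite_of_ncard_ne_zero (by rw [h.ncard_eq L hL]; norm_num))).1
    (by rw [h.ncard_eq L hL]; norm_num)
  obtain ⟨t, rfl⟩ := (Equiv.ofBijective _ hbij).surjective p
  obtain ⟨t', rfl⟩ := (Equiv.ofBijective _ hbij).surjective q
  obtain ⟨l, hl, hl'⟩ := exists_stdInc t t'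
  exact ⟨l, h.line_eq (hmem l) hL hpq ⟨t, hl, rfl⟩ hp ⟨t', hl', rfl⟩ hq⟩

end Plane

/-- The word with support the set bits of `n`. -/
def maskWord (n : ℕ) : StdPoint → ZMod 2 := fun t => if n.testBit (pointIndex t) then 1 else 0

/-- All sums, without carries, of sublists of a list of bit masks. -/
def xorSpan : List ℕ → List ℕ
  | [] => [0]
  | x :: xs => xorSpan xs ++ (xorSpan xs).map (x ^^^ ·)

/-- The indicator word of a line of the standard plane. -/
def lineWord (l : Option (Fin 5 × Fin 4)) : StdPoint → ZMod 2 :=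
  fun t => if stdInc l t then 1 else 0

/-- The bit mask of `lineWord`. -/
def lineMask : Option (Fin 5 × Fin 4) → ℕ
  | none => 2031616
  | some (z, k) => ![![65551, 65776, 69376, 126976], ![135441, 139810, 148548, 166024],
      ![295969, 280594, 270724, 266824], ![534593, 529538, 557588, 540968],
      ![1065601, 1081666, 1054756, 1057816]] z k

/-- Ten lines whose words form a basis of `stdCode`. -/
def basisLines : List (Option (Fin 5 × Fin 4)) :=
  [none, some (0, 0), some (0, 1), some (0, 2), some (1, 0), some (1, 1), some (1, 2),
    some (2, 0), some (2, 1), some (3, 0)]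

/-- The code spanned by the lines of the standard plane. -/
def stdCode : Submodule (ZMod 2) (StdPoint → ZMod 2) := Submodule.span _ (Set.range lineWord)

theorem lineWord_eq (l) : lineWord l = maskWord (lineMask l) := by
  revert l
  decide +kernel

theorem maskWord_xor (m n : ℕ) : maskWord (m ^^^ n) = maskWord m + maskWord n := by
  ext t
  simp only [maskWord, Nat.testBit_xor, Pi.add_apply]
  cases m.testBit (pointIndex t) <;> cases n.testBit (pointIndex t) <;> decide

theorem mem_span_maskWord (xs : List ℕ) (w : StdPoint → ZMod 2) :
    w ∈ Submodule.span (ZMod 2) (maskWord '' {x | x ∈ xs}) ↔ ∃ n ∈ xorSpan xs, maskWord n = w := by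
  induction xs generalizing w with
  | nil =>
    have : maskWord 0 = 0 := by ext t; simp [maskWord]
    simp [xorSpan, this, eq_comm]
  | cons x xs ih =>
    have h : maskWord '' {y | y ∈ x :: xs} = insert (maskWord x) (maskWord '' {y | y ∈ xs}) := by
      rw [← Set.image_insert_eq]
      congr 1
      ext y
      simp
    rw [h, Submodule.mem_span_insert]
    simp only [ih, xorSpan, List.mem_append, List.mem_map]
    constructor
    · rintro ⟨a, _, ⟨n, hn, rfl⟩, rfl⟩
      obtain rfl | rfl : a = 0 ∨ a = 1 := by revert a; decide
      · exact ⟨n, Or.inl hn, by simp⟩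
      · exact ⟨x ^^^ n, Or.inr ⟨n, hn, rfl⟩, by simp [maskWord_xor]⟩
    · rintro ⟨n, hn | ⟨m, hm, rfl⟩, rfl⟩
      · exact ⟨0, _, ⟨n, hn, rfl⟩, by simp⟩
      · exact ⟨1, _, ⟨m, hm, rfl⟩, by simp [maskWord_xor]⟩

theorem lineMask_mem : ∀ l, lineMask l ∈ xorSpan (basisLines.map lineMask) := by
  decide +kernel

theorem stdCode_eq :
    stdCode = Submodule.span _ (maskWord '' {x | x ∈ basisLines.map lineMask}) := by
  apply le_antisymm <;> refine Submodule.span_le.2 ?_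
  · rintro _ ⟨l, rfl⟩
    exact (mem_span_maskWord _ _).2 ⟨_, lineMask_mem l, (lineWord_eq l).symm⟩
  · rintro _ ⟨x, hx, rfl⟩
    obtain ⟨l, -, rfl⟩ := List.mem_map.1 hx
    exact Submodule.subset_span ⟨l, lineWord_eq l⟩

theorem mem_stdCode {w : StdPoint → ZMod 2} :
    w ∈ stdCode ↔ ∃ n ∈ xorSpan (basisLines.map lineMask), maskWord n = w := by
  rw [stdCode_eq, mem_span_maskWord]

theorem xor_mem_xorSpan {xs : List ℕ} {m n : ℕ} (hm : m ∈ xorSpan xs) (hn : n ∈ xorSpan xs) :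
    m ^^^ n ∈ xorSpan xs := by
  induction xs generalizing m n with
  | nil => simp_all [xorSpan]
  | cons x xs ih =>
    simp only [xorSpan, List.mem_append, List.mem_map] at hm hn ⊢
    obtain hm | ⟨m, hm, rfl⟩ := hm <;> obtain hn | ⟨n, hn, rfl⟩ := hn
    · exact Or.inl (ih hm hn)
    · exact Or.inr ⟨_, ih hm hn, Nat.xor_left_comm _ _ _⟩
    · exact Or.inr ⟨_, ih hm hn, (Nat.xor_assoc _ _ _).symm⟩
    · left
      rw [Nat.xor_comm x, Nat.xor_assoc, Nat.xor_xor_cancel_left]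
      exact ih hm hn

theorem nodup_xorSpan_cons {x : ℕ} {xs : List ℕ} (hx : x ∉ xorSpan xs) (h : (xorSpan xs).Nodup) :
    (xorSpan (x :: xs)).Nodup := by
  refine h.append (h.map Nat.xor_right_injective) fun m hm hm' => hx ?_
  obtain ⟨n, hn, rfl⟩ := List.mem_map.1 hm'
  simpa [Nat.xor_assoc] using xor_mem_xorSpan hm hn

theorem xorSpan_nodup : (xorSpan (basisLines.map lineMask)).Nodup := by
  iterate 10 refine nodup_xorSpan_cons (by decide +kernel) ?_
  exact List.nodup_singleton _

theorem xorSpan_lt : ∀ n ∈ xorSpan (basisLines.map lineMask), n < 2 ^ 21 := by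
  decide +kernel

theorem xorSpan_weight : ∀ n ∈ xorSpan (basisLines.map lineMask),
    ((Finset.range 21).filter (n.testBit ·)).card ∈ [0, 5, 8, 9, 12, 13, 16, 21] := by
  decide +kernel

theorem pointIndex_injective : Function.Injective pointIndex := by
  decide +kernel

theorem pointIndex_lt : ∀ t, pointIndex t < 21 := by
  decide

theorem exists_pointIndex_eq : ∀ i : Fin 21, ∃ t, pointIndex t = i := by
  decide

theorem maskWord_injOn : Set.InjOn maskWord {n | n < 2 ^ 21} := by
  intro m hm n hn h
  refine Nat.eq_of_testBit_eq fun i => ?_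
  by_cases hi : i < 21
  · obtain ⟨t, ht⟩ := exists_pointIndex_eq ⟨i, hi⟩
    have := congrFun h t
    simp only [maskWord, ht] at this
    cases h1 : m.testBit i <;> cases h2 : n.testBit i <;> simp_all
  · have h2 : 2 ^ 21 ≤ 2 ^ i := Nat.pow_le_pow_right (by norm_num) (by omega)
    rw [Nat.testBit_lt_two_pow (lt_of_lt_of_le hm h2),
      Nat.testBit_lt_two_pow (lt_of_lt_of_le hn h2)]

theorem card_stdCode : Nat.card stdCode = 2 ^ 10 := by
  have h : (stdCode : Set (StdPoint → ZMod 2)) =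
      ((xorSpan (basisLines.map lineMask)).toFinset.image maskWord : Finset _) := by
    ext w
    simp [mem_stdCode]
  rw [← SetLike.coe_sort_coe, Nat.card_coe_set_eq, h, Set.ncard_coe_finset,
    Finset.card_image_of_injOn, List.toFinset_card_of_nodup xorSpan_nodup]
  · decide +kernel
  · exact maskWord_injOn.mono fun n hn => xorSpan_lt n (by simpa using hn)

theorem goodCode10_stdCode : GoodCode10 StdPoint stdCode := by
  refine ⟨?_, mem_stdCode.2 ⟨2 ^ 21 - 1, by decide +kernel, by decide +kernel⟩, fun w hw => ?_⟩
  · have h := card_stdCode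
    rw [Module.natCard_eq_pow_finrank (K := ZMod 2), Nat.card_zmod] at h
    exact Nat.pow_right_injective le_rfl h
  · obtain ⟨n, hn, rfl⟩ := mem_stdCode.1 hw
    have h : wt (maskWord n) = ((Finset.range 21).filter (n.testBit ·)).card := by
      have h1 : pointIndex '' {t | maskWord n t = 1} =
          ((Finset.range 21).filter (n.testBit ·) : Finset ℕ) := by
        ext i
        simp only [Set.mem_image, Set.mem_ofPred_eq, maskWord, Finset.coe_filter, Finset.mem_range]
        constructor
        · rintro ⟨t, ht, rfl⟩
          exact ⟨pointIndex_lt t, by by_contra h; simp [h] at ht⟩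
        · rintro ⟨hi, h⟩
          obtain ⟨t, ht⟩ := exists_pointIndex_eq ⟨i, hi⟩
          exact ⟨t, by simp [ht, h], ht⟩
      rw [wt, ← Set.ncard_image_of_injective _ pointIndex_injective, h1, Set.ncard_coe_finset]
    rw [h]
    simpa using xorSpan_weight n hn

section Transport

variable {S : Type*}

theorem wt_comp_equiv {U : Type*} (e : S ≃ U) (w : U → ZMod 2) : wt (w ∘ e) = wt w := by
  have h : {x | (w ∘ e) x = 1} = e.symm '' {x | w x = 1} := by
    rw [Equiv.image_symm_eq_preimage]
    rfl
  rw [wt, wt, h, Set.ncard_image_of_injective _ e.symm.injective]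

theorem finrank_map_funLeft {U : Type*} (e : S ≃ U) (D : Submodule (ZMod 2) (U → ZMod 2)) :
    Module.finrank (ZMod 2) (D.map (LinearMap.funLeft (ZMod 2) (ZMod 2) e)) =
      Module.finrank (ZMod 2) D :=
  (Submodule.equivMapOfInjective _
    (LinearMap.funLeft_injective_of_surjective _ _ _ e.surjective) D).finrank_eq.symm

theorem GoodCode10.map_funLeft {U : Type*} {D : Submodule (ZMod 2) (U → ZMod 2)}
    (hD : GoodCode10 U D) (e : S ≃ U) :
    GoodCode10 S (D.map (LinearMap.funLeft (ZMod 2) (ZMod 2) e)) := by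
  refine ⟨(finrank_map_funLeft e D).trans hD.1, ⟨_, hD.2.1, rfl⟩, ?_⟩
  rintro _ ⟨w, hw, rfl⟩
  have h := hD.2.2 w hw
  rwa [← wt_comp_equiv e] at h

theorem span_indicator_eq_map (e : StdPoint ≃ S) :
    Submodule.span (ZMod 2) {w | ∃ L ∈ Set.range fun l => e '' {t | stdInc l t},
      w = Set.indicator L fun _ => (1 : ZMod 2)} =
    stdCode.map (LinearMap.funLeft (ZMod 2) (ZMod 2) e.symm) := by
  rw [stdCode, Submodule.map_span, ← Set.range_comp]
  congr 1
  ext w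
  have h : ∀ l, Set.indicator (e '' {t | stdInc l t}) (fun _ => (1 : ZMod 2)) =
      lineWord l ∘ e.symm := by
    intro l
    ext s
    obtain ⟨t, rfl⟩ := e.surjective s
    by_cases ht : stdInc l t <;> simp [lineWord, ht]
  constructor
  · rintro ⟨_, ⟨l, rfl⟩, rfl⟩
    exact ⟨l, (h l).symm⟩
  · rintro ⟨l, rfl⟩
    exact ⟨_, ⟨l, rfl⟩, (h l).symm⟩

theorem GoodCode10.exists_eq_map {C : Submodule (ZMod 2) (S → ZMod 2)} (hC : GoodCode10 S C)
    (hS : Nat.card S = 21) :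
    ∃ e : StdPoint ≃ S, C = stdCode.map (LinearMap.funLeft (ZMod 2) (ZMod 2) e.symm) := by
  have : Finite S := Nat.finite_of_card_ne_zero (by omega)
  obtain ⟨e, he⟩ := (hC.isPlane hS).exists_equiv hS
  refine ⟨e, (Submodule.eq_of_le_of_finrank_eq ?_ ?_).symm⟩
  · rw [← span_indicator_eq_map, ← he, Submodule.span_le]
    rintro _ ⟨L, hL, rfl⟩
    exact hL.1
  · rw [finrank_map_funLeft, goodCode10_stdCode.1, hC.1]

end Transport

section ProjectivePlane

open Configuration Configuration.ofField Projectivization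

variable {F : Type*} [Field F]

theorem isProjLine_iff {L : Set (Projectivization F (Fin 3 → F))} :
    IsProjLine F L ↔ ∃ q : Projectivization F (Fin 3 → F), L = {p | p ∈ q} := by
  have key : ∀ (v : Fin 3 → F) (hv : v ≠ 0) (p : Projectivization F (Fin 3 → F)),
      p ∈ mk F v hv ↔ Fintype.linearCombination F v p.rep = 0 := by
    intro v hv p
    rw [mem_iff]
    conv_lhs => rw [← p.mk_rep]
    rw [orthogonal_mk, Fintype.linearCombination_apply]
    rfl
  have hlin : ∀ v : Fin 3 → F, Fintype.linearCombination F v = 0 → v = 0 := by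
    intro v hv
    ext i
    simpa using LinearMap.congr_fun hv (Pi.single i 1)
  constructor
  · rintro ⟨φ, hφ, rfl⟩
    have hφv : φ = Fintype.linearCombination F fun i => φ (Pi.single i 1) := by
      ext i
      simp
    have hv : (fun i => φ (Pi.single i 1)) ≠ 0 := by
      intro h
      rw [h] at hφv
      refine hφ (hφv.trans ?_)
      ext i
      simp
    refine ⟨mk F _ hv, Set.ext fun p => ?_⟩
    rw [Set.mem_ofPred_eq, Set.mem_ofPred_eq, key, ← hφv]
  · rintro ⟨q, rfl⟩
    refine ⟨Fintype.linearCombination F q.rep, fun h => q.rep_nonzero (hlin _ h), ?_⟩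
    ext p
    rw [Set.mem_ofPred_eq, Set.mem_ofPred_eq, ← key q.rep q.rep_nonzero, q.mk_rep]

variable [Fintype F]

theorem card_projectivization (hF : Fintype.card F = 4) :
    Nat.card (Projectivization F (Fin 3 → F)) = 21 := by
  rw [card_of_finrank F _ (Module.finrank_fin_fun F), Nat.card_eq_fintype_card, hF]
  rfl

theorem isPlane_isProjLine (hF : Fintype.card F = 4) : IsPlane {L | IsProjLine F L} := by
  classical
  have hcard := card_projectivization hF
  have : Finite (Projectivization F (Fin 3 → F)) := Nat.finite_of_card_ne_zero (by omega)
  have := Fintype.ofFinite (Projectivization F (Fin 3 → F))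
  have horder : ProjectivePlane.order (Projectivization F (Fin 3 → F))
      (Projectivization F (Fin 3 → F)) = 4 := by
    have h := ProjectivePlane.card_points (Projectivization F (Fin 3 → F))
      (Projectivization F (Fin 3 → F))
    rw [← Nat.card_eq_fintype_card, hcard] at h
    nlinarith
  refine ⟨fun L hL => ?_, fun p q hpq => ?_, fun L hL M hM hLM => ?_⟩
  · obtain ⟨q, rfl⟩ := isProjLine_iff.1 hL
    have h := ProjectivePlane.pointCount_eq (Projectivization F (Fin 3 → F)) q
    rw [horder] at h
    exact h
  · exact ⟨_, isProjLine_iff.2 ⟨_, rfl⟩, orthogonal_cross_left hpq, orthogonal_cross_right hpq⟩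
  · obtain ⟨q, rfl⟩ := isProjLine_iff.1 hL
    obtain ⟨r, rfl⟩ := isProjLine_iff.1 hM
    have hqr : q ≠ r := fun h => hLM (h ▸ rfl)
    refine ⟨cross q r, Set.eq_singleton_iff_unique_mem.2
      ⟨⟨cross_orthogonal_left hqr, cross_orthogonal_right hqr⟩, fun p hp => ?_⟩⟩
    exact (eq_or_eq_of_orthogonal hp.1 (cross_orthogonal_left hqr) hp.2
      (cross_orthogonal_right hqr)).resolve_right hqr

theorem goodCode10_CDK (hF : Fintype.card F = 4) :
    GoodCode10 (Projectivization F (Fin 3 → F)) (CDK F) := by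
  obtain ⟨e, he⟩ := (isPlane_isProjLine hF).exists_equiv (card_projectivization hF)
  have h : CDK F = stdCode.map (LinearMap.funLeft (ZMod 2) (ZMod 2) e.symm) := by
    rw [← span_indicator_eq_map, ← he]
    rfl
  rw [h]
  exact goodCode10_stdCode.map_funLeft e.symm

end ProjectivePlane

/-- on a 21-element set `S` there is, up to the action of the symmetric group
of `S`, exactly one `F₂`-linear code of dimension 10 containing the full word `S` all of
whose weights lie in `{0,5,8,9,12,13,16,21}`; and for any bijection `γ : S ≃ P²(F₄)` the
pull-back `γ⁻¹(C_DK)` of the Dolgachev–Kondō code is such a code. -/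
theorem unique_code_dim10 (F : Type*) [Field F] [Fintype F] (hF : Fintype.card F = 4)
    (S : Type*) (hS : Nat.card S = 21) :
    (∃ C : Submodule (ZMod 2) (S → ZMod 2), GoodCode10 S C) ∧
    (∀ C₁ C₂ : Submodule (ZMod 2) (S → ZMod 2), GoodCode10 S C₁ → GoodCode10 S C₂ →
      ∃ σ : Equiv.Perm S, Submodule.map (LinearMap.funLeft (ZMod 2) (ZMod 2) ⇑σ) C₁ = C₂) ∧
    (∀ γ : S ≃ Projectivization F (Fin 3 → F),
      GoodCode10 S (Submodule.map (LinearMap.funLeft (ZMod 2) (ZMod 2) ⇑γ) (CDK F))) := by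
  refine ⟨?_, fun C₁ C₂ h₁ h₂ => ?_, fun γ => (goodCode10_CDK hF).map_funLeft γ⟩
  · have : Finite S := Nat.finite_of_card_ne_zero (by omega)
    have : Finite (Projectivization F (Fin 3 → F)) :=
      Nat.finite_of_card_ne_zero (by rw [card_projectivization hF]; decide)
    obtain ⟨e⟩ := Finite.card_eq.1 (hS.trans (card_projectivization hF).symm)
    exact ⟨_, (goodCode10_CDK hF).map_funLeft e⟩
  · obtain ⟨e₁, rfl⟩ := h₁.exists_eq_map hS
    obtain ⟨e₂, rfl⟩ := h₂.exists_eq_map hS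
    refine ⟨e₂.symm.trans e₁, ?_⟩
    rw [← Submodule.map_comp, ← LinearMap.funLeft_comp]
    congr 2
    ext s
    simp
end
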